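/- arXiv:2207.07404 — 2 statements merged into one kernel-verified Lean document; each statement's English description precedes it below -/
import Mathlib

section
/- Let G be a finite group. There exist finite-dimensional real representations V₀ and V₁ of G that are primary matched (over ℝ) and satisfy dim_ℝ V₀^G = 0 and dim_ℝ V₁^G = 1, if and only if G has subgroups K and H with K normal in H ≤ G such that the quotient group H/K is isomorphic to the dihedral group of order 2pq for some two distinct primes p and q. -/
/-- Two finite-dimensional real representations of `G` are *primary matched over ℝ* if
for every prime `p` and every `p`-subgroup `P` of `G`, their restrictions to `P` are
isomorphic as real representations of `P`. -/
def PrimaryMatchedReal {G : Type} [Group G] (V₀ V₁ : FDRep ℝ G) : Prop :=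
  ∀ (p : ℕ), p.Prime → ∀ P : Subgroup G, IsPGroup p P →
    ∃ e : V₀ ≃ₗ[ℝ] V₁, ∀ g ∈ P, ∀ v : V₀, e (V₀.ρ g v) = V₁.ρ g (e v)

/-- `G` has subgroups `K ⊴ H ≤ G` with `H/K` isomorphic to the dihedral group of order
`2pq` for distinct primes `p`, `q`; equivalently, there is a surjective homomorphism
from some subgroup `H` of `G` onto `DihedralGroup (p * q)` (whose kernel is the normal
subgroup `K` of `H`). -/
def HasDihedralSubquotient (G : Type*) [Group G] : Prop :=
  ∃ (p q : ℕ), p.Prime ∧ q.Prime ∧ p ≠ q ∧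
    ∃ (H K : Subgroup G), K ≤ H ∧
      ∃ φ : H →* DihedralGroup (p * q), Function.Surjective φ ∧
        MonoidHom.ker φ = K.subgroupOf H

theorem exists_coind_equiv {G : Type} [Group G] {H : Subgroup G} {A : Type} [AddCommGroup A]
    [Module ℝ A] (σ₀ σ₁ : Representation ℝ H A) (P : Subgroup G)
    (h : ∀ g : G, ∃ T : A ≃ₗ[ℝ] A, ∀ k : H, g⁻¹ * k * g ∈ P → ∀ a, T (σ₀ k a) = σ₁ k (T a)) :
    ∃ e : Representation.coindV H.subtype σ₀ ≃ₗ[ℝ] Representation.coindV H.subtype σ₁,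
      ∀ g ∈ P, ∀ v, e (Representation.coind H.subtype σ₀ g v) =
        Representation.coind H.subtype σ₁ g (e v) := by
  classical
  let s : Setoid G := DoubleCoset.setoid (H : Set G) (P : Set G)
  let r : G → G := fun g => (Quotient.mk s g).out
  have hrep : ∀ g : G, ∃ k : H, ∃ x ∈ P, g = k * r g * x := by
    intro g
    have h1 : s (Quotient.mk s g).out g := Quotient.exact (Quotient.out_eq _)
    obtain ⟨a, ha, b, hb, hab⟩ := DoubleCoset.rel_iff.1 h1
    exact ⟨⟨a, ha⟩, b, hb, hab⟩
  have hr : ∀ (k : H) (g x : G), x ∈ P → r (k * g * x) = r g := by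
    intro k g x hx
    have : s g (k * g * x) := DoubleCoset.rel_iff.2 ⟨k, k.2, x, hx, rfl⟩
    simp only [r]
    rw [Quotient.sound this]
  choose c x hx hc using hrep
  choose T hT using h
  have inv₀ : ∀ (k : H) a, σ₀ k (σ₀ k⁻¹ a) = a := fun k a => by
    rw [← Module.End.mul_apply, ← map_mul]; simp
  have inv₀' : ∀ (k : H) a, σ₀ k⁻¹ (σ₀ k a) = a := fun k a => by
    rw [← Module.End.mul_apply, ← map_mul]; simp
  have inv₁ : ∀ (k : H) a, σ₁ k (σ₁ k⁻¹ a) = a := fun k a => by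
    rw [← Module.End.mul_apply, ← map_mul]; simp
  have inv₁' : ∀ (k : H) a, σ₁ k⁻¹ (σ₁ k a) = a := fun k a => by
    rw [← Module.End.mul_apply, ← map_mul]; simp
  let U : G → A →ₗ[ℝ] A := fun g => σ₁ (c g) ∘ₗ (T (r g)).toLinearMap ∘ₗ σ₀ (c g)⁻¹
  let U' : G → A →ₗ[ℝ] A := fun g => σ₀ (c g) ∘ₗ (T (r g)).symm.toLinearMap ∘ₗ σ₁ (c g)⁻¹
  have hUU' : ∀ g a, U g (U' g a) = a := by
    intro g a; simp [U, U', inv₀', inv₁]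
  have hU'U : ∀ g a, U' g (U g a) = a := by
    intro g a; simp [U, U', inv₀, inv₁']
  have hU : ∀ (k : H) (g y : G) (a : A), y ∈ P → U (k * g * y) (σ₀ k a) = σ₁ k (U g a) := by
    intro k g y a hy
    have hcc := hc (k * g * y)
    rw [hr k g y hy] at hcc
    set k' := c (k * g * y) with hk'
    have h3 : (r g)⁻¹ * ((k'⁻¹ * k * c g : H) : G) * r g ∈ P := by
      have : (r g)⁻¹ * ((k'⁻¹ * k * c g : H) : G) * r g = x (k * g * y) * y⁻¹ * (x g)⁻¹ := by
        have h4 := hc g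
        have h5 : (k : G) * (c g * r g * x g) * y = k' * r g * x (k * g * y) := by
          rw [← h4]; exact hcc
        push_cast
        have h6 : (k'⁻¹ : G) * (k * (c g * r g * x g) * y) = r g * x (k * g * y) := by
          rw [h5]; group
        calc _ = (r g)⁻¹ * ((k'⁻¹ : G) * (k * (c g * r g * x g) * y)) * y⁻¹ * (x g)⁻¹ := by group
          _ = _ := by rw [h6]; group
      rw [this]
      exact P.mul_mem (P.mul_mem (hx _) (P.inv_mem hy)) (P.inv_mem (hx _))
    have h7 := hT (r g) _ h3 (σ₀ (c g)⁻¹ a)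
    simp only [U, LinearMap.comp_apply, LinearEquiv.coe_coe]
    rw [hr k g y hy, ← hk']
    have h8 : σ₀ (k'⁻¹ * k * c g) (σ₀ (c g)⁻¹ a) = σ₀ k'⁻¹ (σ₀ k a) := by
      rw [map_mul, map_mul, Module.End.mul_apply, Module.End.mul_apply, inv₀]
    rw [h8] at h7
    rw [h7, map_mul, map_mul, Module.End.mul_apply, Module.End.mul_apply, inv₁]
  have hU' : ∀ (k : H) (g y : G) (a : A), y ∈ P → U' (k * g * y) (σ₁ k a) = σ₀ k (U' g a) := by
    intro k g y a hy
    have := hU k g y (U' g a) hy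
    rw [hUU'] at this
    rw [← this, hU'U]
  let e : Representation.coindV H.subtype σ₀ ≃ₗ[ℝ] Representation.coindV H.subtype σ₁ :=
    { toFun := fun f => ⟨fun g => U g (f.1 g), fun k g => by
        have h1 := f.2 k g
        have h2 := hU k g 1 (f.1 g) P.one_mem
        rw [mul_one] at h2
        rw [← h2, ← h1]; rfl⟩
      invFun := fun f => ⟨fun g => U' g (f.1 g), fun k g => by
        have h1 := f.2 k g
        have h2 := hU' k g 1 (f.1 g) P.one_mem
        rw [mul_one] at h2
        rw [← h2, ← h1]; rfl⟩
      left_inv := fun f => by ext g; exact hU'U g _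
      right_inv := fun f => by ext g; exact hUU' g _
      map_add' := fun f f' => by ext g; exact map_add (U g) _ _
      map_smul' := fun t f => by ext g; exact map_smul (U g) _ _ }
  refine ⟨e, fun p hp f => ?_⟩
  ext g
  change U g (f.1 (g * p)) = U (g * p) (f.1 (g * p))
  have h1 := hU 1 g p (f.1 (g * p)) hp
  simpa using h1.symm

open scoped ComplexConjugate in
/-- The action of the dihedral group on the plane in which rotations act through the
character `χ` and `sr 0` acts by complex conjugation. -/
noncomputable def dihedralPlane {n : ℕ} [NeZero n] (χ : AddChar (ZMod n) ℂ) :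
    Representation ℝ (DihedralGroup n) ℂ where
  toFun d := match d with
    | .r j => LinearMap.mulLeft ℝ (χ j)
    | .sr j => Complex.conjAe.toLinearMap ∘ₗ LinearMap.mulLeft ℝ (χ j)
  map_one' := by
    rw [DihedralGroup.one_def]; ext; simp
  map_mul' a b := by
    rcases a with i | i <;> rcases b with j | j <;> refine LinearMap.ext fun z => ?_
    · simp [AddChar.map_add_eq_mul]
    · simp [sub_eq_add_neg, AddChar.map_add_eq_mul, AddChar.map_neg_eq_conj]; ring
    · simp [AddChar.map_add_eq_mul]
    · simp [sub_eq_add_neg, AddChar.map_add_eq_mul, AddChar.map_neg_eq_conj]; ring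

open scoped ComplexConjugate

theorem dihedralPlane_r {n : ℕ} [NeZero n] (χ : AddChar (ZMod n) ℂ) (j : ZMod n) (z : ℂ) :
    dihedralPlane χ (.r j) z = χ j * z := rfl

theorem dihedralPlane_sr {n : ℕ} [NeZero n] (χ : AddChar (ZMod n) ℂ) (j : ZMod n) (z : ℂ) :
    dihedralPlane χ (.sr j) z = conj (χ j * z) := rfl

theorem exists_dihedralPlane_twist {n : ℕ} [NeZero n] (χ : AddChar (ZMod n) ℂ)
    (S : Subgroup (DihedralGroup n)) (hS : ∀ j, DihedralGroup.r j ∈ S → χ j = 1) :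
    ∃ α : ℂ, α ≠ 0 ∧ ∀ (ψ : AddChar (ZMod n) ℂ), ∀ d ∈ S, ∀ z,
      α * dihedralPlane (χ * ψ) d z = dihedralPlane ψ d (α * z) := by
  have hα : ∃ α : ℂ, α ≠ 0 ∧ ∀ j, DihedralGroup.sr j ∈ S → α * conj (χ j) = conj α := by
    by_cases h : ∃ j, DihedralGroup.sr j ∈ S
    · obtain ⟨i, hi⟩ := h
      obtain ⟨α, hα⟩ := IsAlgClosed.exists_pow_nat_eq (χ i) (n := 2) (by norm_num)
      have h1 : ‖χ i‖ = 1 := AddChar.norm_apply _ _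
      have h2 : ‖α‖ = 1 := by
        have : ‖α‖ ^ 2 = 1 := by rw [← norm_pow, hα, h1]
        nlinarith [norm_nonneg α]
      refine ⟨α, fun h0 => by simp [h0] at h2, fun j hj => ?_⟩
      have h3 : χ j = χ i := by
        have := hS (j - i) (by rw [← DihedralGroup.sr_mul_sr]; exact S.mul_mem hi hj)
        have h4 : j = (j - i) + i := by ring
        rw [h4, AddChar.map_add_eq_mul, this, one_mul]
      have h5 : α * conj α = 1 := by rw [Complex.mul_conj, Complex.normSq_eq_norm_sq, h2]; simp
      rw [h3, ← hα, map_pow, pow_two, ← mul_assoc, h5, one_mul]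
    · exact ⟨1, one_ne_zero, fun j hj => (h ⟨j, hj⟩).elim⟩
  obtain ⟨α, h0, hα⟩ := hα
  refine ⟨α, h0, fun ψ d hd z => ?_⟩
  rcases d with j | j
  · rw [dihedralPlane_r, dihedralPlane_r, AddChar.mul_apply, hS j hd]; ring
  · rw [dihedralPlane_sr, dihedralPlane_sr, AddChar.mul_apply]
    simp only [map_mul]
    rw [← hα j hd]; ring

/-- Multiplication by a nonzero complex number, as a real linear automorphism. -/
noncomputable def complexScale (α : ℂ) (h : α ≠ 0) : ℂ ≃ₗ[ℝ] ℂ :=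
  (LinearEquiv.smulOfNeZero ℂ ℂ α h).restrictScalars ℝ

theorem complexScale_apply (α : ℂ) (h : α ≠ 0) (z : ℂ) : complexScale α h z = α * z := rfl

theorem exists_dihedralPlane_prod_equiv {n : ℕ} [NeZero n] (χ ψ : AddChar (ZMod n) ℂ)
    (S : Subgroup (DihedralGroup n))
    (hS : (∀ j, DihedralGroup.r j ∈ S → χ j = 1) ∨ ∀ j, DihedralGroup.r j ∈ S → ψ j = 1) :
    ∃ T : (ℂ × ℂ) ≃ₗ[ℝ] (ℂ × ℂ), ∀ d ∈ S, ∀ a,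
      T ((dihedralPlane χ).prod (dihedralPlane ψ) d a) =
        (dihedralPlane 1).prod (dihedralPlane (χ * ψ)) d (T a) := by
  have key : ∀ χ ψ : AddChar (ZMod n) ℂ, (∀ j, DihedralGroup.r j ∈ S → χ j = 1) →
      ∃ T : (ℂ × ℂ) ≃ₗ[ℝ] (ℂ × ℂ), ∀ d ∈ S, ∀ a,
      T ((dihedralPlane χ).prod (dihedralPlane ψ) d a) =
        (dihedralPlane 1).prod (dihedralPlane (χ * ψ)) d (T a) := by
    intro χ ψ h
    obtain ⟨α, h0, hα⟩ := exists_dihedralPlane_twist χ S h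
    refine ⟨(complexScale α h0).prodCongr (complexScale α h0).symm, fun d hd a => ?_⟩
    refine Prod.ext ?_ ?_
    · change complexScale α h0 (dihedralPlane χ d a.1) = dihedralPlane 1 d (complexScale α h0 a.1)
      rw [complexScale_apply, complexScale_apply, ← hα 1 d hd, mul_one]
    · change (complexScale α h0).symm (dihedralPlane ψ d a.2) =
        dihedralPlane (χ * ψ) d ((complexScale α h0).symm a.2)
      rw [LinearEquiv.symm_apply_eq, complexScale_apply, hα ψ d hd, ← complexScale_apply α h0,
        LinearEquiv.apply_symm_apply]
  rcases hS with hS | hS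
  · exact key χ ψ hS
  · obtain ⟨T, hT⟩ := key ψ χ hS
    refine ⟨(LinearEquiv.prodComm ℝ ℂ ℂ).trans T, fun d hd a => ?_⟩
    have := hT d hd a.swap
    rw [mul_comm ψ χ] at this
    exact this

theorem mem_invariants_coind {G : Type} [Group G] {H : Subgroup G} {A : Type} [AddCommGroup A]
    [Module ℝ A] (σ : Representation ℝ H A) (f : Representation.coindV H.subtype σ)
    (hf : f ∈ (Representation.coind H.subtype σ).invariants) :
    (∀ g, f.1 g = f.1 1) ∧ ∀ k : H, σ k (f.1 1) = f.1 1 := by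
  have h1 : ∀ g, f.1 g = f.1 1 := fun g => by
    have h2 : f.1 (1 * g) = f.1 1 := congrArg (fun v => v.1 1) (hf g)
    rwa [one_mul] at h2
  refine ⟨h1, fun k => ?_⟩
  have h2 := f.2 k 1
  rw [← h2]
  exact h1 _

theorem stdAddChar_pow_one_ne_one {n k : ℕ} [NeZero n] (h : ¬ n ∣ k) :
    ((ZMod.stdAddChar (N := n)) ^ k) 1 ≠ 1 := by
  intro h1
  rw [AddChar.pow_apply, ← AddChar.map_nsmul_eq_pow] at h1
  rw [← AddChar.map_zero_eq_one (ZMod.stdAddChar (N := n))] at h1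
  have := ZMod.injective_stdAddChar h1
  rw [nsmul_one, ZMod.natCast_eq_zero_iff] at this
  exact h this

theorem char_eq_one_of_isPGroup {p q l : ℕ} [NeZero (p * q)] (hq : q.Prime)
    (hl : l.Prime) (hlq : l ≠ q) {S : Subgroup (DihedralGroup (p * q))} (hS : IsPGroup l S)
    (j : ZMod (p * q)) (hj : DihedralGroup.r j ∈ S) :
    ((ZMod.stdAddChar (N := p * q)) ^ p) j = 1 := by
  obtain ⟨k, hk⟩ := hS ⟨_, hj⟩
  have hk' : (DihedralGroup.r j) ^ l ^ k = 1 := by simpa using congrArg Subtype.val hk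
  have h1 : (DihedralGroup.r j) ^ (p * q) = 1 := by
    rw [DihedralGroup.r_pow, ZMod.natCast_self, mul_zero, DihedralGroup.r_zero]
  have h2 : orderOf (DihedralGroup.r j) ∣ p := by
    refine Nat.Coprime.dvd_of_dvd_mul_right ?_ (orderOf_dvd_of_pow_eq_one h1)
    exact Nat.Coprime.coprime_dvd_left (orderOf_dvd_of_pow_eq_one hk')
      (Nat.Coprime.pow_left _ ((Nat.coprime_primes hl hq).2 hlq))
  have h3 : DihedralGroup.r j ^ p = 1 := orderOf_dvd_iff_pow_eq_one.1 h2
  rw [DihedralGroup.r_pow, DihedralGroup.one_def, DihedralGroup.r.injEq] at h3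
  rw [AddChar.pow_apply, ← AddChar.map_nsmul_eq_pow, nsmul_eq_mul,
    mul_comm (p : ZMod (p * q)) j, h3,
    AddChar.map_zero_eq_one]

theorem dihedralPlane_prod_fixed {n : ℕ} [NeZero n] {χ ψ : AddChar (ZMod n) ℂ} {a : ℂ × ℂ}
    (ha : ∀ d, (dihedralPlane χ).prod (dihedralPlane ψ) d a = a) :
    (χ 1 ≠ 1 → a.1 = 0) ∧ (ψ 1 ≠ 1 → a.2 = 0) ∧ conj a.1 = a.1 := by
  have h1 : χ 1 * a.1 = a.1 := congrArg Prod.fst (ha (.r 1))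
  have h2 : ψ 1 * a.2 = a.2 := congrArg Prod.snd (ha (.r 1))
  have h3 : conj (χ 0 * a.1) = a.1 := congrArg Prod.fst (ha (.sr 0))
  refine ⟨fun h => ?_, fun h => ?_, by simpa using h3⟩
  · by_contra h0; exact h (by simpa [h0] using h1)
  · by_contra h0; exact h (by simpa [h0] using h2)

theorem exists_primaryMatched_of_dihedral {G : Type} [Group G] [Finite G]
    (hG : HasDihedralSubquotient G) :
    ∃ V₀ V₁ : FDRep ℝ G, PrimaryMatchedReal V₀ V₁ ∧
        Module.finrank ℝ (Representation.invariants V₀.ρ) = 0 ∧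
        Module.finrank ℝ (Representation.invariants V₁.ρ) = 1 := by
  obtain ⟨p, q, hp, hq, hpq, H, K, -, φ, hφ, -⟩ := hG
  have : NeZero (p * q) := ⟨Nat.mul_ne_zero hp.ne_zero hq.ne_zero⟩
  let χ := (ZMod.stdAddChar (N := p * q)) ^ p
  let ψ := (ZMod.stdAddChar (N := p * q)) ^ q
  let σ₀ : Representation ℝ H (ℂ × ℂ) := ((dihedralPlane χ).prod (dihedralPlane ψ)).comp φ
  let σ₁ : Representation ℝ H (ℂ × ℂ) := ((dihedralPlane 1).prod (dihedralPlane (χ * ψ))).comp φ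
  refine ⟨FDRep.of (Representation.coind H.subtype σ₀),
    FDRep.of (Representation.coind H.subtype σ₁),
    ?_, ?_, ?_⟩
  · intro l hl P hP
    refine exists_coind_equiv σ₀ σ₁ P fun g => ?_
    let S := ((P.map (MulAut.conj g).toMonoidHom).comap H.subtype).map φ
    have hS : IsPGroup l S :=
      ((hP.map _).comap_of_injective _ H.subtype_injective).map _
    obtain ⟨T, hT⟩ := exists_dihedralPlane_prod_equiv χ ψ S (by
      by_cases hlq : l = q
      · right
        have hlp : l ≠ p := by rw [hlq]; exact hpq.symm
        have : ∀ m, m = q * p → ∀ [NeZero m], ∀ S : Subgroup (DihedralGroup m), IsPGroup l S →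
            ∀ j, DihedralGroup.r j ∈ S → ((ZMod.stdAddChar (N := m)) ^ q) j = 1 := by
          rintro m rfl _ S hS j hj
          exact char_eq_one_of_isPGroup hp hl hlp hS j hj
        exact this _ (mul_comm p q) S hS
      · left
        exact char_eq_one_of_isPGroup hq hl hlq hS)
    refine ⟨T, fun k hk a => hT (φ k) ⟨k, ⟨_, hk, ?_⟩, rfl⟩ a⟩
    simp
    group
  · change Module.finrank ℝ (Representation.invariants (Representation.coind H.subtype σ₀)) = 0
    rw [Submodule.finrank_eq_zero, eq_bot_iff]
    intro f hf
    obtain ⟨h1, h2⟩ := mem_invariants_coind σ₀ f hf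
    obtain ⟨h3, h4, -⟩ := dihedralPlane_prod_fixed (χ := χ) (ψ := ψ) (a := f.1 1) (fun d => by
      obtain ⟨k, rfl⟩ := hφ d
      exact h2 k)
    rw [Submodule.mem_bot]
    ext g : 2
    rw [h1]
    refine Prod.ext (h3 (stdAddChar_pow_one_ne_one ?_)) (h4 (stdAddChar_pow_one_ne_one ?_))
    · intro h
      exact hq.one_lt.ne' (Nat.dvd_one.1 (Nat.dvd_of_mul_dvd_mul_left hp.pos (by rwa [mul_one])))
    · intro h
      rw [mul_comm] at h
      exact hp.one_lt.ne' (Nat.dvd_one.1 (Nat.dvd_of_mul_dvd_mul_left hq.pos (by rwa [mul_one])))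
  · change Module.finrank ℝ (Representation.invariants (Representation.coind H.subtype σ₁)) = 1
    have hfix : ∀ d, (dihedralPlane 1).prod (dihedralPlane (χ * ψ)) d (1, 0) = (1, 0) := by
      intro d
      refine Prod.ext ?_ (map_zero (dihedralPlane (χ * ψ) d))
      rcases d with j | j
      · change dihedralPlane 1 (.r j) 1 = 1
        simp [dihedralPlane_r]
      · change dihedralPlane 1 (.sr j) 1 = 1
        simp [dihedralPlane_sr]
    let v : (Representation.coind H.subtype σ₁).invariants :=
      ⟨⟨fun _ => (1, 0), fun k _ => (hfix (φ k)).symm⟩, fun g => by ext g : 2; rfl⟩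
    have hv : ∀ g, v.1.1 g = (1, 0) := fun g => rfl
    refine finrank_eq_one v ?_ ?_
    · intro h0
      have := hv 1
      rw [h0] at this
      exact zero_ne_one (congrArg Prod.fst this)
    · intro f
      obtain ⟨h1, h2⟩ := mem_invariants_coind σ₁ f.1 f.2
      obtain ⟨-, h4, h5⟩ := dihedralPlane_prod_fixed (χ := 1) (ψ := χ * ψ)
          (a := f.1.1 1) (fun d => by
        obtain ⟨k, rfl⟩ := hφ d
        exact h2 k)
      refine ⟨(f.1.1 1).1.re, ?_⟩
      ext g : 3
      rw [h1 g]
      change (f.1.1 1).1.re • v.1.1 g = _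
      rw [hv]
      refine Prod.ext ?_ ?_
      · simpa using (Complex.conj_eq_iff_re.1 h5)
      · rw [h4]
        · simp
        · simp only [χ, ψ, ← pow_add]
          refine stdAddChar_pow_one_ne_one fun h => ?_
          have h6 : p ∣ q := (Nat.dvd_add_right (dvd_refl p)).1 ((Dvd.intro _ rfl).trans h)
          exact hpq ((Nat.prime_dvd_prime_iff_eq hp hq).1 h6)

theorem HasDihedralSubquotient.of_surjective {G : Type*} [Group G] {p q : ℕ} (hp : p.Prime)
    (hq : q.Prime) (hpq : p ≠ q) (H : Subgroup G) (φ : H →* DihedralGroup (p * q))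
    (hφ : Function.Surjective φ) : HasDihedralSubquotient G :=
  ⟨p, q, hp, hq, hpq, H, φ.ker.map H.subtype, Subgroup.map_subtype_le _, φ, hφ,
    (Subgroup.comap_map_eq_self_of_injective H.subtype_injective _).symm⟩

theorem HasDihedralSubquotient.of_subgroup {G : Type*} [Group G] {E : Subgroup G}
    (h : HasDihedralSubquotient E) : HasDihedralSubquotient G := by
  obtain ⟨p, q, hp, hq, hpq, H, -, -, φ, hφ, -⟩ := h
  let e := H.equivMapOfInjective E.subtype E.subtype_injective
  exact .of_surjective hp hq hpq (H.map E.subtype) (φ.comp e.symm.toMonoidHom)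
    (hφ.comp e.symm.surjective)

/-- A pair of elements satisfying the dihedral relations gives a homomorphism from the
dihedral group, injective if the orders are the expected ones. -/
theorem exists_dihedralGroup_hom_injective {L : Type*} [Group L] {n : ℕ} (a b : L)
    (ha : ∀ i : ℤ, a ^ i = 1 ↔ (n : ℤ) ∣ i) (hb : b * b = 1) (hab : b * a * b⁻¹ = a⁻¹)
    (hne : ∀ i : ℤ, b * a ^ i ≠ 1) :
    ∃ f : DihedralGroup n →* L, Function.Injective f := by
  let P : ZMod n →+ Additive L := ZMod.lift n ⟨zmultiplesHom _ (Additive.ofMul a), by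
    rw [zmultiplesHom_apply, ← ofMul_zpow, (ha n).2 dvd_rfl]; rfl⟩
  let pw : ZMod n → L := fun j => (P j).toMul
  have pw_int : ∀ i : ℤ, pw (i : ZMod n) = a ^ i := fun i => by
    simp only [pw, P, ZMod.lift_coe, zmultiplesHom_apply]
    rfl
  have hsurj : ∀ j : ZMod n, ∃ i : ℤ, (i : ZMod n) = j := ZMod.intCast_surjective
  have pw_add : ∀ i j, pw (i + j) = pw i * pw j := fun i j => by simp [pw]
  have pw_neg : ∀ i, pw (-i) = (pw i)⁻¹ := fun i => by simp [pw]
  have hbinv : b⁻¹ = b := inv_eq_of_mul_eq_one_left hb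
  have hconj : ∀ j, pw j * b = b * pw (-j) := by
    intro j
    obtain ⟨i, rfl⟩ := hsurj j
    rw [pw_neg, pw_int, ← inv_zpow, ← hab, conj_zpow]
    simp only [hbinv, ← mul_assoc, hb, one_mul]
  let f : DihedralGroup n →* L :=
    { toFun := fun d => match d with
        | .r j => pw j
        | .sr j => b * pw j
      map_one' := by
        rw [DihedralGroup.one_def]
        simp [pw]
      map_mul' := by
        rintro (i | i) (j | j)
        · simp [pw_add]
        · simp only [DihedralGroup.r_mul_sr]
          rw [← mul_assoc, hconj, mul_assoc, ← pw_add, sub_eq_neg_add]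
        · simp [pw_add, mul_assoc]
        · simp only [DihedralGroup.sr_mul_sr]
          rw [mul_assoc, ← mul_assoc (pw i), hconj, mul_assoc, ← mul_assoc b, hb, one_mul,
            ← pw_add, sub_eq_neg_add] }
  refine ⟨f, (injective_iff_map_eq_one f).2 ?_⟩
  rintro (j | j) h
  · obtain ⟨i, rfl⟩ := hsurj j
    change pw _ = 1 at h
    rw [pw_int, ha] at h
    rw [DihedralGroup.one_def, DihedralGroup.r.injEq]
    exact (ZMod.intCast_zmod_eq_zero_iff_dvd _ _).2 h
  · obtain ⟨i, rfl⟩ := hsurj j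
    change b * pw _ = 1 at h
    rw [pw_int] at h
    exact (hne i h).elim

theorem HasDihedralSubquotient.of_normalizer {G : Type*} [Group G] {p q : ℕ} (hp : p.Prime)
    (hq : q.Prime) (hpq : p ≠ q) {K : Subgroup G} {g x : G}
    (hgN : g ∈ Subgroup.normalizer (K : Set G)) (hxN : x ∈ Subgroup.normalizer (K : Set G))
    (hg : ∀ i : ℤ, g ^ i ∈ K ↔ ((p * q : ℕ) : ℤ) ∣ i) (hx : x * x ∈ K)
    (hxg : x * g * x⁻¹ * g ∈ K) (hne : ∀ i : ℤ, x * g ^ i ∉ K) : HasDihedralSubquotient G := by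
  let N := Subgroup.normalizer (K : Set G)
  let π := QuotientGroup.mk' (K.subgroupOf N)
  have hπ : ∀ y : N, π y = 1 ↔ (y : G) ∈ K := fun y => by
    rw [QuotientGroup.mk'_apply, QuotientGroup.eq_one_iff, Subgroup.mem_subgroupOf]
  let a : N := ⟨g, hgN⟩
  let b : N := ⟨x, hxN⟩
  obtain ⟨f, hf⟩ := exists_dihedralGroup_hom_injective (n := p * q) (π a) (π b)
    (fun i => by rw [← map_zpow, hπ]; exact hg i)
    (by rw [← map_mul, hπ]; exact hx)
    (by rw [← mul_eq_one_iff_eq_inv, ← map_inv, ← map_mul, ← map_mul, ← map_mul, hπ]; exact hxg)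
    (fun i => by rw [← map_zpow, ← map_mul, Ne, hπ]; exact hne i)
  let H := f.range.comap π
  let φ : H →* DihedralGroup (p * q) :=
    (MonoidHom.ofInjective hf).symm.toMonoidHom.comp (π.subgroupComap f.range)
  have hφ : Function.Surjective φ :=
    (MonoidHom.ofInjective hf).symm.surjective.comp
      (π.subgroupComap_surjective_of_surjective _ (QuotientGroup.mk'_surjective _))
  exact .of_subgroup (.of_surjective hp hq hpq H φ hφ)

theorem eq_one_of_pow_two_pow_of_odd {G : Type*} [Group G] {a : G} {k m : ℕ}
    (h : a ^ 2 ^ k = 1) (hm : Odd m) (h' : a ^ m = 1) : a = 1 := by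
  have h1 : orderOf a ∣ Nat.gcd (2 ^ k) m :=
    Nat.dvd_gcd (orderOf_dvd_of_pow_eq_one h) (orderOf_dvd_of_pow_eq_one h')
  have h2 : Nat.gcd (2 ^ k) m = 1 := Nat.Coprime.pow_left _ (Nat.coprime_two_left.2 hm)
  rw [h2, Nat.dvd_one, orderOf_eq_one_iff] at h1
  exact h1

theorem IsPGroup.eq_one_of_odd {G : Type*} [Group G] {R : Subgroup G} (hR : IsPGroup 2 R)
    {a : G} (ha : a ∈ R) {m : ℕ} (hm : Odd m) (h' : a ^ m = 1) : a = 1 := by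
  obtain ⟨k, hk⟩ := hR ⟨a, ha⟩
  exact eq_one_of_pow_two_pow_of_odd (k := k) (by simpa using congrArg Subtype.val hk) hm h'

theorem Subgroup.mem_normalizer_of_forall_conj_mem {G : Type*} [Group G] [Finite G]
    {K : Subgroup G} {g : G} (h : ∀ k ∈ K, g * k * g⁻¹ ∈ K) :
    g ∈ Subgroup.normalizer (K : Set G) := by
  have hinj : Function.Injective (fun k : K => (⟨g * k * g⁻¹, h k k.2⟩ : K)) := fun a b hab => by
    simpa using congrArg Subtype.val hab
  refine Subgroup.mem_normalizer_iff.2 fun k => ⟨fun hk => h k hk, fun hk => ?_⟩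
  obtain ⟨⟨l, hl⟩, hl'⟩ := Finite.surjective_of_injective hinj ⟨_, hk⟩
  have h1 : g * l * g⁻¹ = g * k * g⁻¹ := congrArg Subtype.val hl'
  have h2 : l = k := by simpa using h1
  rwa [← h2]

theorem hasDihedralSubquotient_of_odd_order_inverted {G : Type*} [Group G] [Finite G] {p q : ℕ}
    (hp : p.Prime) (hq : q.Prime) (hpq : p ≠ q) {c t : G} (hodd : Odd (p * q))
    (hc : orderOf c = p * q) {k : ℕ} (ht : t ^ 2 ^ k = 1) (htc : t * c * t⁻¹ = c⁻¹) :
    HasDihedralSubquotient G := by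
  have hcomm : Commute (t * t) c := by
    have h1 : t * (t * c * t⁻¹) * t⁻¹ = c := by
      calc t * (t * c * t⁻¹) * t⁻¹ = t * c⁻¹ * t⁻¹ := by rw [htc]
        _ = (t * c * t⁻¹)⁻¹ := by group
        _ = c := by rw [htc, inv_inv]
    have h2 : t * t * c = c * (t * t) := by
      nth_rewrite 2 [← h1]
      group
    exact h2
  have hcz : ∀ s ∈ Subgroup.zpowers (t * t), Commute s c := by
    rintro _ ⟨i, rfl⟩
    exact hcomm.zpow_left i
  have htz : ∀ s ∈ Subgroup.zpowers (t * t), Commute s t := by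
    rintro _ ⟨i, rfl⟩
    exact (Commute.mul_left (Commute.refl t) (Commute.refl t)).zpow_left i
  have hzz : Subgroup.zpowers (t * t) ≤ Subgroup.zpowers t := by
    rw [Subgroup.zpowers_le]
    exact ⟨2, zpow_two t⟩
  have h2 : ∀ i : ℤ, c ^ i ∈ Subgroup.zpowers t → c ^ i = 1 := by
    rintro i ⟨j, hj⟩
    simp only at hj
    refine eq_one_of_pow_two_pow_of_odd (k := k) ?_ hodd ?_
    · rw [← hj, ← zpow_natCast, ← zpow_mul, mul_comm, zpow_mul, zpow_natCast, ht, one_zpow]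
    · rw [← zpow_natCast, ← zpow_mul, mul_comm, zpow_mul, zpow_natCast, ← hc, pow_orderOf_eq_one,
        one_zpow]
  refine .of_normalizer hp hq hpq (K := Subgroup.zpowers (t * t)) (g := c) (x := t) ?_ ?_ ?_
    (Subgroup.mem_zpowers _) ?_ ?_
  · refine Subgroup.mem_normalizer_of_forall_conj_mem fun s hs => ?_
    rwa [(hcz s hs).symm.eq, mul_inv_cancel_right]
  · refine Subgroup.mem_normalizer_of_forall_conj_mem fun s hs => ?_
    rwa [(htz s hs).symm.eq, mul_inv_cancel_right]
  · intro i
    rw [← hc, orderOf_dvd_iff_zpow_eq_one]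
    exact ⟨fun h => h2 i (hzz h), fun h => by rw [h]; exact one_mem _⟩
  · rw [htc, inv_mul_cancel]; exact one_mem _
  · intro i hi
    have h3 : c ^ i = 1 := h2 i (by
      have := Subgroup.mul_mem _ (Subgroup.inv_mem _ (Subgroup.mem_zpowers t)) (hzz hi)
      rwa [inv_mul_cancel_left] at this)
    rw [h3, mul_one] at hi
    have h4 := hcz t hi
    rw [h4.eq, mul_inv_cancel_right] at htc
    have h5 : c ^ 2 = 1 := by rw [pow_two]; nth_rewrite 1 [htc]; exact inv_mul_cancel c
    have h6 : c ^ 2 ^ 1 = 1 := by simpa using h5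
    have h7 := eq_one_of_pow_two_pow_of_odd h6 hodd (by rw [← hc, pow_orderOf_eq_one])
    rw [h7, orderOf_one] at hc
    exact hp.one_lt.ne' (Nat.eq_one_of_mul_eq_one_right hc.symm)

theorem hasDihedralSubquotient_of_two_group_inverting {G : Type*} [Group G] [Finite G] {q : ℕ}
    (hq : q.Prime) (hq2 : q ≠ 2) {c x : G} (hc : orderOf c = q) {R : Subgroup G}
    (hR : IsPGroup 2 R) (hRc : ∀ r ∈ R, r * c * r⁻¹ = c ∨ r * c * r⁻¹ = c⁻¹) (hx : x ∈ R)
    (hxc : x * c * x⁻¹ = c⁻¹) (hne : Subgroup.zpowers x ≠ R) : HasDihedralSubquotient G := by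
  have hqodd : Odd q := hq.odd_of_ne_two hq2
  have hcne : c ≠ c⁻¹ := fun h => by
    have h5 : c ^ 2 ^ 1 = 1 := by
      rw [pow_one, pow_two]; nth_rewrite 1 [h]; exact inv_mul_cancel c
    have h7 := eq_one_of_pow_two_pow_of_odd h5 hqodd (by rw [← hc, pow_orderOf_eq_one])
    rw [h7, orderOf_one] at hc
    exact hq.one_lt.ne hc
  have hle : Subgroup.zpowers x ≤ R := by rwa [Subgroup.zpowers_le]
  -- an index two subgroup of `R` containing `x`
  obtain ⟨M, hxM, hM⟩ : ∃ M : Subgroup R, (⟨x, hx⟩ : R) ∈ M ∧ M.index = 2 := by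
    have : Fact (Nat.Prime 2) := ⟨Nat.prime_two⟩
    obtain ⟨n, hn⟩ := IsPGroup.iff_card.1 hR
    obtain ⟨j, hj⟩ := IsPGroup.iff_card.1 (hR.to_subgroup (Subgroup.zpowers (⟨x, hx⟩ : R)))
    have hjn : j < n := by
      have h1 : (Subgroup.zpowers (⟨x, hx⟩ : R)) ≠ ⊤ := by
        intro h
        refine hne (le_antisymm hle fun r hr => ?_)
        have : (⟨r, hr⟩ : R) ∈ Subgroup.zpowers (⟨x, hx⟩ : R) := by rw [h]; trivial
        obtain ⟨i, hi⟩ := this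
        exact ⟨i, by simpa using congrArg Subtype.val hi⟩
      have h2 : Nat.card (Subgroup.zpowers (⟨x, hx⟩ : R)) < Nat.card R := by
        refine lt_of_le_of_ne (Subgroup.card_le_card_group _) fun h => h1 ?_
        exact Subgroup.eq_top_of_card_eq _ h
      rw [hj, hn] at h2
      exact (Nat.pow_lt_pow_iff_right (by norm_num)).1 h2
    obtain ⟨M, hM, hle⟩ := Sylow.exists_subgroup_card_pow_prime_le 2 (m := n - 1)
      (by rw [hn]; exact pow_dvd_pow _ (Nat.sub_le _ _)) _ hj (by omega)
    refine ⟨M, hle (Subgroup.mem_zpowers _), ?_⟩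
    have h3 := M.card_mul_index
    rw [hM, hn] at h3
    have h4 : 2 ^ n = 2 ^ (n - 1) * 2 := by rw [← pow_succ]; congr 1; omega
    rw [h4] at h3
    exact Nat.eq_of_mul_eq_mul_left (by positivity) h3
  have hcomm_iff : ∀ r, r * c * r⁻¹ = c ↔ Commute r c := fun r => by
    rw [mul_inv_eq_iff_eq_mul]; rfl
  -- an element outside `M` commuting with `c`
  obtain ⟨y, hy, hyM, hyc⟩ : ∃ y, ∃ hy : y ∈ R, (⟨y, hy⟩ : R) ∉ M ∧ Commute y c := by
    obtain ⟨y, hy⟩ : ∃ y, y ∉ M := by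
      by_contra! h
      rw [(Subgroup.eq_top_iff' M).2 h, Subgroup.index_top] at hM
      norm_num at hM
    rcases hRc y y.2 with h | h
    · exact ⟨y, y.2, hy, (hcomm_iff _).1 h⟩
    · refine ⟨x * y, R.mul_mem hx y.2, fun h' => hy ?_, ?_⟩
      · exact (Subgroup.mul_mem_cancel_left M hxM).1 h'
      · rw [← hcomm_iff]
        calc x * y * c * (x * y)⁻¹ = x * (y * c * (y : G)⁻¹) * x⁻¹ := by group
          _ = (x * c * x⁻¹)⁻¹ := by rw [h]; group
          _ = c := by rw [hxc, inv_inv]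
  have hMn : M.Normal := Subgroup.normal_of_index_eq_two hM
  let K : Subgroup G := M.map R.subtype ⊓ Subgroup.centralizer {c}
  have hKmem : ∀ {k}, k ∈ K ↔ (∃ h : k ∈ R, (⟨k, h⟩ : R) ∈ M) ∧ Commute k c := by
    intro k
    simp only [K, Subgroup.mem_inf, Subgroup.mem_map, Subgroup.mem_centralizer_singleton_iff]
    constructor
    · rintro ⟨⟨k, hk, rfl⟩, h⟩; exact ⟨⟨k.2, hk⟩, h⟩
    · rintro ⟨⟨h1, h2⟩, h⟩; exact ⟨⟨_, h2, rfl⟩, h⟩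
  have hKR : ∀ {k}, k ∈ K → k ∈ R := fun hk => (hKmem.1 hk).1.1
  have hRN : ∀ r ∈ R, r ∈ Subgroup.normalizer (K : Set G) := by
    refine fun r hr => Subgroup.mem_normalizer_of_forall_conj_mem fun k hk => ?_
    obtain ⟨⟨h1, h2⟩, h3⟩ := hKmem.1 hk
    refine hKmem.2 ⟨⟨R.mul_mem (R.mul_mem hr h1) (R.inv_mem hr), hMn.conj_mem _ h2 ⟨r, hr⟩⟩, ?_⟩
    have h4 : Commute (r * k * r⁻¹) (r * c * r⁻¹) := (Commute.conj_iff r).2 h3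
    rcases hRc r hr with h | h
    · rwa [h] at h4
    · rw [h] at h4; exact Commute.inv_right_iff.1 h4
  have hcN : c ∈ Subgroup.normalizer (K : Set G) := by
    refine Subgroup.mem_normalizer_of_forall_conj_mem fun k hk => ?_
    rwa [(hKmem.1 hk).2.symm.eq, mul_inv_cancel_right]
  have hcR : ∀ i : ℤ, c ^ i ∈ R → c ^ i = 1 := fun i hi => by
    refine hR.eq_one_of_odd hi hqodd ?_
    rw [← zpow_natCast, ← zpow_mul, mul_comm, zpow_mul, zpow_natCast, ← hc, pow_orderOf_eq_one,
      one_zpow]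
  have hyy : y * y ∈ K := hKmem.2 ⟨⟨R.mul_mem hy hy,
    Subgroup.mul_self_mem_of_index_two hM ⟨y, hy⟩⟩, hyc.mul_left hyc⟩
  have hcy : ∀ i : ℤ, (c * y) ^ i = c ^ i * y ^ i := fun i => hyc.symm.mul_zpow i
  refine .of_normalizer Nat.prime_two hq hq2.symm (K := K) (g := c * y) (x := x)
    (Subgroup.mul_mem _ hcN (hRN y hy)) (hRN x hx) ?_ ?_ ?_ ?_
  · intro i
    rw [hcy]
    constructor
    · intro h
      have h1 : c ^ i = 1 := hcR i (by
        have := R.mul_mem (hKR h) (R.inv_mem (R.zpow_mem hy i))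
        rwa [mul_inv_cancel_right] at this)
      have h2 : (q : ℤ) ∣ i := by rw [← hc, orderOf_dvd_iff_zpow_eq_one]; exact h1
      have h3 : (2 : ℤ) ∣ i := by
        by_contra h3
        obtain ⟨j, rfl⟩ := Int.not_even_iff_odd.1 (fun h => h3 h.two_dvd)
        rw [h1, one_mul, zpow_add, zpow_mul, zpow_one] at h
        have h4 : y ∈ K := by
          refine (Subgroup.mul_mem_cancel_left K (K.zpow_mem ?_ j)).1 h
          rw [zpow_two]; exact hyy
        exact hyM (hKmem.1 h4).1.2
      push_cast
      refine IsCoprime.mul_dvd ?_ h3 h2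
      exact_mod_cast (Nat.isCoprime_iff_coprime (m := 2) (n := q)).2 (Nat.coprime_two_left.2 hqodd)
    · rintro ⟨j, rfl⟩
      have h1 : c ^ (((2 * q : ℕ) : ℤ) * j) = 1 := by
        rw [← orderOf_dvd_iff_zpow_eq_one, hc]
        exact ⟨2 * j, by push_cast; ring⟩
      have h2 : y ^ (((2 * q : ℕ) : ℤ) * j) = (y * y) ^ ((q : ℤ) * j) := by
        rw [← zpow_two, ← zpow_mul]; congr 1; push_cast; ring
      rw [h1, one_mul, h2]
      exact K.zpow_mem hyy _
  · refine hKmem.2 ⟨⟨R.mul_mem hx hx, Subgroup.mul_self_mem_of_index_two hM ⟨x, hx⟩⟩, ?_⟩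
    rw [← hcomm_iff]
    calc x * x * c * (x * x)⁻¹ = x * (x * c * x⁻¹) * x⁻¹ := by group
      _ = x * c⁻¹ * x⁻¹ := by rw [hxc]
      _ = (x * c * x⁻¹)⁻¹ := by group
      _ = c := by rw [hxc, inv_inv]
  · have h0 : x * (c * y) * x⁻¹ * (c * y) = x * y * x⁻¹ * y := by
      have h1 : Commute (x * y * x⁻¹) c⁻¹ := by
        rw [← hxc]; exact (Commute.conj_iff x).2 hyc
      calc x * (c * y) * x⁻¹ * (c * y) = (x * c * x⁻¹) * (x * y * x⁻¹) * c * y := by group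
        _ = x * y * x⁻¹ * y := by rw [hxc, ← h1.eq]; group
    rw [h0]
    have h1 : Commute (x * y * x⁻¹) c := by
      rw [← Commute.inv_right_iff, ← hxc]; exact (Commute.conj_iff x).2 hyc
    refine hKmem.2 ⟨⟨R.mul_mem (R.mul_mem (R.mul_mem hx hy) (R.inv_mem hx)) hy, ?_⟩,
      h1.mul_left hyc⟩
    have h2 : (⟨y, hy⟩ : R) * ⟨x, hx⟩⁻¹ * ⟨y, hy⟩ ∈ M := by
      have h3 : (⟨y, hy⟩ : R) * ⟨x, hx⟩⁻¹ ∉ M := fun h =>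
        hyM ((Subgroup.mul_mem_cancel_right M (M.inv_mem hxM)).1 h)
      exact (Subgroup.mul_mem_iff_of_index_two hM).2 (iff_of_false h3 hyM)
    have h4 := M.mul_mem hxM h2
    convert h4 using 1
    ext
    simp [mul_assoc]
  · intro i hi
    rw [hcy] at hi
    have h1 : c ^ i = 1 := hcR i (by
      have h2 := R.mul_mem (R.mul_mem (R.inv_mem hx) (hKR hi)) (R.inv_mem (R.zpow_mem hy i))
      have h3 : x⁻¹ * (x * (c ^ i * y ^ i)) * (y ^ i)⁻¹ = c ^ i := by group
      rwa [h3] at h2)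
    rw [h1, one_mul] at hi
    have h2 : Commute x c := by
      have h3 := (hKmem.1 hi).2.mul_left (hyc.zpow_left i).inv_left
      rwa [mul_inv_cancel_right] at h3
    rw [(hcomm_iff x).2 h2] at hxc
    exact hcne hxc

open scoped ComplexConjugate

/-- An antilinear map `J` with `J² = -1` forces the complex dimension to be even. -/
theorem even_finrank_of_antilinear_sq_eq_neg {W : Type*} [AddCommGroup W] [Module ℂ W]
    [FiniteDimensional ℂ W] (J : W →ₛₗ[starRingEnd ℂ] W) (hJ : ∀ w, J (J w) = -w) :
    Even (Module.finrank ℂ W) := by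
  let b := Module.finBasis ℂ W
  let A : Matrix (Fin (Module.finrank ℂ W)) (Fin (Module.finrank ℂ W)) ℂ :=
    fun i j => b.repr (J (b j)) i
  have hA : A * A.map (starRingEnd ℂ) = -1 := by
    ext k j
    have h1 : J (b j) = ∑ i, A i j • b i := (b.sum_repr _).symm
    have h2 : b.repr (J (J (b j))) k = ∑ i, conj (A i j) * A k i := by
      rw [h1, map_sum, map_sum, Finsupp.finsetSum_apply]
      refine Finset.sum_congr rfl fun i _ => ?_
      rw [LinearMap.map_smulₛₗ, map_smul, Finsupp.smul_apply, smul_eq_mul]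
    rw [hJ, map_neg, Module.Basis.repr_self] at h2
    rw [Matrix.mul_apply, Matrix.neg_apply, Matrix.one_apply]
    rw [Finsupp.neg_apply, Finsupp.single_apply] at h2
    simp only [Matrix.map_apply, mul_comm (A k _)]
    rw [← h2]
    simp only [eq_comm]
  have hdet := congrArg Matrix.det hA
  have hmap : (A.map (starRingEnd ℂ)).det = conj A.det := ((starRingEnd ℂ).map_det A).symm
  rw [Matrix.det_mul, hmap, Complex.mul_conj, Matrix.det_neg, Matrix.det_one, mul_one,
    Fintype.card_fin] at hdet
  by_contra hodd
  rw [Nat.not_even_iff_odd] at hodd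
  rw [hodd.neg_one_pow] at hdet
  have h3 : Complex.normSq A.det = -1 := by exact_mod_cast hdet
  linarith [Complex.normSq_nonneg A.det]

section Twist

variable {G H : Type*} [Group G] [Group H] {n : ℕ}

/-- The complexification of a real matrix representation, pulled back along `f` and twisted by
the inverse of the linear character `ψ`. -/
noncomputable def twistedComplexification (ρ : G →* Matrix (Fin n) (Fin n) ℝ) (f : H →* G)
    (ψ : H →* ℂˣ) : Representation ℂ H (Fin n → ℂ) where
  toFun h := ((ψ h)⁻¹ : ℂˣ).val • Matrix.toLin' ((ρ (f h)).map Complex.ofRealHom)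
  map_one' := by
    simp
    rfl
  map_mul' a b := by
    rw [map_mul, map_mul, map_mul, Matrix.map_mul, Matrix.toLin'_mul, mul_inv, Units.val_mul,
      smul_mul_smul_comm]
    rfl

theorem twistedComplexification_character (ρ : G →* Matrix (Fin n) (Fin n) ℝ) (f : H →* G)
    (ψ : H →* ℂˣ) (h : H) : (twistedComplexification ρ f ψ).character h =
      ((ψ h)⁻¹ : ℂˣ).val * ((ρ (f h)).trace : ℂ) := by
  change LinearMap.trace ℂ (Fin n → ℂ)
    (((ψ h)⁻¹ : ℂˣ).val • Matrix.toLin' ((ρ (f h)).map Complex.ofRealHom)) = _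
  rw [map_smul, Matrix.trace_toLin'_eq, smul_eq_mul]
  congr 1
  simp [Matrix.trace]

theorem mem_invariants_twistedComplexification {ρ : G →* Matrix (Fin n) (Fin n) ℝ} {f : H →* G}
    {ψ : H →* ℂˣ} {w : Fin n → ℂ} : w ∈ (twistedComplexification ρ f ψ).invariants ↔
      ∀ h, ((ρ (f h)).map Complex.ofRealHom).mulVec w = (ψ h : ℂ) • w := by
  refine forall_congr' fun h => ?_
  change ((ψ h)⁻¹ : ℂˣ).val • Matrix.toLin' _ w = w ↔ _
  rw [Matrix.toLin'_apply, ← Units.smul_def, inv_smul_eq_iff, Units.smul_def]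

theorem sum_twisted_trace_eq_finrank [Fintype H] (ρ : G →* Matrix (Fin n) (Fin n) ℝ)
    (f : H →* G) (ψ : H →* ℂˣ) :
    ∑ h, ((ψ h)⁻¹ : ℂˣ).val * ((ρ (f h)).trace : ℂ) =
      Nat.card H * Module.finrank ℂ (twistedComplexification ρ f ψ).invariants := by
  have h0 : (Nat.card H : ℂ) ≠ 0 := by exact_mod_cast Nat.card_pos.ne'
  have : Invertible (Nat.card H : ℂ) := invertibleOfNonzero h0
  rw [← Representation.card_inv_mul_sum_char_eq_finrank, mul_inv_cancel_left₀ h0]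
  simp only [twistedComplexification_character]

theorem conj_mulVec_map_ofReal (M : Matrix (Fin n) (Fin n) ℝ) (w : Fin n → ℂ) (i : Fin n) :
    conj ((M.map Complex.ofRealHom).mulVec w i) =
      (M.map Complex.ofRealHom).mulVec (fun j => conj (w j)) i := by
  simp [Matrix.mulVec, dotProduct]

theorem Complex.conj_unitsHom_apply [Finite H] (ψ : H →* ℂˣ) (h : H) :
    conj (ψ h : ℂ) = ((ψ h)⁻¹ : ℂˣ).val := by
  have h1 : ‖(ψ h : ℂ)‖ = 1 := by
    refine Complex.norm_eq_one_of_pow_eq_one (n := Nat.card H) ?_ Nat.card_pos.ne'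
    rw [← Units.val_pow_eq_pow_val, ← map_pow, pow_card_eq_one', map_one, Units.val_one]
  rw [Units.val_inv_eq_inv_val, Complex.inv_def, Complex.normSq_eq_norm_sq, h1]
  simp

theorem even_finrank_invariants_twistedComplexification [Finite H]
    (ρ : G →* Matrix (Fin n) (Fin n) ℝ) (f : H →* G) (ψ : H →* ℂˣ) (x : G)
    (hx : ∀ h, ∃ h', x * f h' = f h * x ∧ ψ h = (ψ h')⁻¹) (h₀ : H) (hh₀ : f h₀ = x * x)
    (hψ : ψ h₀ = -1) :
    Even (Module.finrank ℂ (twistedComplexification ρ f ψ).invariants) := by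
  let J₀ : (Fin n → ℂ) →ₛₗ[starRingEnd ℂ] (Fin n → ℂ) :=
    { toFun := fun w => ((ρ x).map Complex.ofRealHom).mulVec fun i => conj (w i)
      map_add' := fun v w => by
        rw [← Matrix.mulVec_add]; congr 1; ext i; simp
      map_smul' := fun a w => by
        rw [← Matrix.mulVec_smul]; congr 1; ext i; simp }
  have hJ₀ : ∀ w, J₀ w = ((ρ x).map Complex.ofRealHom).mulVec fun i => conj (w i) := fun _ => rfl
  have hmul : ∀ a b : G, ((ρ a).map Complex.ofRealHom) * ((ρ b).map Complex.ofRealHom) =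
      (ρ (a * b)).map Complex.ofRealHom := fun a b => by rw [map_mul, Matrix.map_mul]
  have hmem : ∀ w ∈ (twistedComplexification ρ f ψ).invariants,
      J₀ w ∈ (twistedComplexification ρ f ψ).invariants := by
    intro w hw
    rw [mem_invariants_twistedComplexification] at hw ⊢
    intro h
    obtain ⟨h', h1, h2⟩ := hx h
    have h3 : ((ρ (f h')).map Complex.ofRealHom).mulVec (fun i => conj (w i)) =
        (ψ h : ℂ) • fun i => conj (w i) := by
      ext i
      rw [← conj_mulVec_map_ofReal, hw]
      simp [Complex.conj_unitsHom_apply, h2]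
    rw [hJ₀, Matrix.mulVec_mulVec, hmul, ← h1, ← hmul, ← Matrix.mulVec_mulVec, h3,
      Matrix.mulVec_smul]
  let J : (twistedComplexification ρ f ψ).invariants →ₛₗ[starRingEnd ℂ]
      (twistedComplexification ρ f ψ).invariants :=
    { toFun := fun w => ⟨J₀ w, hmem w w.2⟩
      map_add' := fun v w => Subtype.ext (map_add J₀ _ _)
      map_smul' := fun a w => Subtype.ext (LinearMap.map_smulₛₗ J₀ a w) }
  refine even_finrank_of_antilinear_sq_eq_neg J fun w => Subtype.ext ?_
  change J₀ (J₀ w) = -(w : Fin n → ℂ)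
  have h4 := mem_invariants_twistedComplexification.1 w.2 h₀
  rw [hψ, hh₀] at h4
  have h5 : (fun i => conj (J₀ w i)) = ((ρ x).map Complex.ofRealHom).mulVec w := by
    ext i
    rw [hJ₀, conj_mulVec_map_ofReal]
    simp
  rw [hJ₀, h5, Matrix.mulVec_mulVec, hmul, h4]
  simp

end Twist

/-- `χ` is a difference of two characters of real representations of `G`. -/
def IsRealVirtualCharacter {G : Type*} [Group G] (χ : G → ℂ) : Prop :=
  ∃ (m n : ℕ) (ρ : G →* Matrix (Fin m) (Fin m) ℝ) (σ : G →* Matrix (Fin n) (Fin n) ℝ),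
    ∀ g, χ g = ((ρ g).trace : ℂ) - ((σ g).trace : ℂ)

namespace IsRealVirtualCharacter

variable {G : Type*} [Group G] {χ : G → ℂ}

theorem comp (hχ : IsRealVirtualCharacter χ) {H : Type*} [Group H] (f : H →* G) :
    IsRealVirtualCharacter fun h => χ (f h) := by
  obtain ⟨m, n, ρ, σ, h⟩ := hχ
  exact ⟨m, n, ρ.comp f, σ.comp f, fun g => h (f g)⟩

theorem apply_conj (hχ : IsRealVirtualCharacter χ) (g x : G) : χ (x * g * x⁻¹) = χ g := by
  obtain ⟨m, n, ρ, σ, h⟩ := hχ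
  have key : ∀ {k : ℕ} (τ : G →* Matrix (Fin k) (Fin k) ℝ),
      (τ (x * g * x⁻¹)).trace = (τ g).trace := fun τ => by
    rw [map_mul, Matrix.trace_mul_comm, ← map_mul]
    congr 2
    group
  rw [h, h, key, key]

theorem conj_apply (hχ : IsRealVirtualCharacter χ) (g : G) : conj (χ g) = χ g := by
  obtain ⟨m, n, ρ, σ, h⟩ := hχ
  simp [h]

theorem exists_int_sum (hχ : IsRealVirtualCharacter χ) {H : Type*} [Group H] [Fintype H]
    (f : H →* G) (ψ : H →* ℂˣ) :
    ∃ k : ℤ, ∑ h, ((ψ h)⁻¹ : ℂˣ).val * χ (f h) = Nat.card H * k := by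
  obtain ⟨m, n, ρ, σ, h⟩ := hχ
  refine ⟨Module.finrank ℂ (twistedComplexification ρ f ψ).invariants -
    Module.finrank ℂ (twistedComplexification σ f ψ).invariants, ?_⟩
  simp only [h, mul_sub, Finset.sum_sub_distrib, sum_twisted_trace_eq_finrank]
  push_cast
  ring

theorem exists_even_sum (hχ : IsRealVirtualCharacter χ) {H : Type*} [Group H] [Fintype H]
    (f : H →* G) (ψ : H →* ℂˣ) (x : G)
    (hx : ∀ h, ∃ h', x * f h' = f h * x ∧ ψ h = (ψ h')⁻¹) (h₀ : H) (hh₀ : f h₀ = x * x)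
    (hψ : ψ h₀ = -1) :
    ∃ k : ℤ, Even k ∧ ∑ h, ((ψ h)⁻¹ : ℂˣ).val * χ (f h) = Nat.card H * k := by
  obtain ⟨m, n, ρ, σ, h⟩ := hχ
  refine ⟨Module.finrank ℂ (twistedComplexification ρ f ψ).invariants -
    Module.finrank ℂ (twistedComplexification σ f ψ).invariants, ?_, ?_⟩
  · refine Even.sub ?_ ?_ <;>
    exact_mod_cast even_finrank_invariants_twistedComplexification _ f ψ x hx h₀ hh₀ hψ
  · simp only [h, mul_sub, Finset.sum_sub_distrib, sum_twisted_trace_eq_finrank]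
    push_cast
    ring

end IsRealVirtualCharacter

theorem MulAction.card_dvd_sum_of_card_stabilizer_dvd {Γ X : Type*} [Group Γ] [Finite Γ]
    [MulAction Γ X] [Fintype X] (F : X → ℤ) (hF : ∀ (γ : Γ) x, F (γ • x) = F x)
    (h : ∀ x, (Nat.card (MulAction.stabilizer Γ x) : ℤ) ∣ F x) :
    (Nat.card Γ : ℤ) ∣ ∑ x, F x := by
  classical
  have : Fintype (Quotient (MulAction.orbitRel Γ X)) := Fintype.ofFinite _
  rw [← Finset.sum_fiberwise (s := Finset.univ)
    (g := fun x : X => (Quotient.mk (MulAction.orbitRel Γ X) x))]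
  refine Finset.dvd_sum fun ω _ => ?_
  induction ω using Quotient.inductionOn with
  | _ x₀ =>
    have h1 : ∀ x, Quotient.mk (MulAction.orbitRel Γ X) x = Quotient.mk _ x₀ ↔
        x ∈ MulAction.orbit Γ x₀ := fun x => Quotient.eq.trans MulAction.orbitRel_apply
    have h2 : ∀ x ∈ Finset.univ.filter
        (fun x => Quotient.mk (MulAction.orbitRel Γ X) x = Quotient.mk _ x₀), F x = F x₀ := by
      intro x hx
      rw [Finset.mem_filter, h1] at hx
      obtain ⟨γ, rfl⟩ := hx.2
      exact hF γ x₀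
    rw [Finset.sum_congr rfl h2, Finset.sum_const, nsmul_eq_mul]
    have h3 : (Finset.univ.filter
        (fun x => Quotient.mk (MulAction.orbitRel Γ X) x = Quotient.mk _ x₀)).card =
        (MulAction.stabilizer Γ x₀).index := by
      rw [MulAction.index_stabilizer, ← Set.ncard_coe_finset]
      congr 1
      ext x
      simp [h1]
    rw [h3, ← (MulAction.stabilizer Γ x₀).index_mul_card, Nat.cast_mul]
    exact mul_dvd_mul_left _ (h x₀)

theorem Equiv.Perm.natCard_modEq_natCard_fixed {α : Type*} [Finite α] {σ : Equiv.Perm α} {k : ℕ}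
    (hσ : σ ^ 2 ^ k = 1) : Nat.card α ≡ Nat.card {x // σ x = x} [MOD 2] := by
  have : Fact (Nat.Prime 2) := ⟨Nat.prime_two⟩
  have h1 : IsPGroup 2 (Subgroup.zpowers σ) := by
    rintro ⟨_, i, rfl⟩
    refine ⟨k, Subtype.ext ?_⟩
    change (σ ^ i) ^ 2 ^ k = 1
    rw [← zpow_natCast, ← zpow_mul, mul_comm, zpow_mul, zpow_natCast, hσ, one_zpow]
  refine (h1.card_modEq_card_fixedPoints α).trans (congrArg (· % 2) (Nat.card_congr ?_))
  refine Equiv.subtypeEquivRight fun x => ⟨fun h => h ⟨σ, Subgroup.mem_zpowers σ⟩, ?_⟩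
  rintro h ⟨_, i, rfl⟩
  exact Function.IsFixedPt.perm_zpow h i

theorem Equiv.Perm.even_sum_of_even_of_fixed {ι : Type*} [Fintype ι] {σ : Equiv.Perm ι} {k : ℕ}
    (hσ : σ ^ 2 ^ k = 1) {f : ι → ℤ} (hf : ∀ i, f (σ i) = f i)
    (h : ∀ i, σ i = i → Even (f i)) : Even (∑ i, f i) := by
  classical
  have hS : ∀ i, ¬Even (f i) ↔ ¬Even (f (σ i)) := fun i => by rw [hf]
  let τ : Equiv.Perm {i // ¬Even (f i)} := σ.subtypePerm fun i => (hS i).symm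
  have h1 : τ ^ 2 ^ k = 1 := by
    rw [Equiv.Perm.subtypePerm_pow]
    ext i
    simp [hσ]
  have h2 := Equiv.Perm.natCard_modEq_natCard_fixed h1
  have h3 : IsEmpty {x // τ x = x} := ⟨fun x => x.1.2 (h x.1 (congrArg Subtype.val x.2))⟩
  rw [Nat.card_of_isEmpty (α := {x // τ x = x}), Nat.modEq_zero_iff_dvd, ← even_iff_two_dvd,
    Nat.card_eq_fintype_card] at h2
  rw [← ZMod.intCast_eq_zero_iff_even, Int.cast_sum]
  have h4 : ∀ i, (f i : ZMod 2) = if ¬Even (f i) then 1 else 0 := fun i => by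
    by_cases h5 : Even (f i)
    · rw [if_neg (not_not.2 h5)]
      exact ZMod.intCast_eq_zero_iff_even.2 h5
    · rw [if_pos h5]
      exact ZMod.intCast_eq_one_iff_odd.2 (Int.not_even_iff_odd.1 h5)
  rw [Finset.sum_congr rfl fun i _ => h4 i, Finset.sum_boole, ← Fintype.card_subtype]
  exact (ZMod.natCast_eq_zero_iff_even).2 h2

/-- Variant with one distinguished fixed point. -/
theorem Equiv.Perm.even_sum_sub_of_even_of_fixed {ι : Type*} [Fintype ι] {σ : Equiv.Perm ι}
    {k : ℕ} (hσ : σ ^ 2 ^ k = 1) {f : ι → ℤ} (hf : ∀ i, f (σ i) = f i) {i₀ : ι}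
    (hi₀ : σ i₀ = i₀) (h : ∀ i, σ i = i → i ≠ i₀ → Even (f i)) :
    Even (∑ i, f i - f i₀) := by
  classical
  have h1 : ∑ i, f i - f i₀ = ∑ i, if i = i₀ then 0 else f i := by
    rw [← Finset.add_sum_erase _ _ (Finset.mem_univ i₀), add_sub_cancel_left,
      ← Finset.add_sum_erase _ _ (Finset.mem_univ i₀), if_pos rfl, zero_add]
    refine Finset.sum_congr rfl fun i hi => (if_neg (Finset.ne_of_mem_erase hi)).symm
  rw [h1]
  refine even_sum_of_even_of_fixed hσ (fun i => ?_) fun i hi => ?_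
  · have h2 : σ i = i₀ ↔ i = i₀ := by
      constructor
      · intro h3
        exact σ.injective (h3.trans hi₀.symm)
      · rintro rfl
        exact hi₀
    simp only [h2, hf]
  · split_ifs with h2
    · exact Even.zero
    · exact h i hi h2

theorem sum_unitsHom_apply {A : Type*} [CommGroup A] [Finite A] [Fintype (A →* ℂˣ)]
    [DecidableEq A] (a : A) :
    ∑ l : A →* ℂˣ, (l a : ℂ) = if a = 1 then (Nat.card A : ℂ) else 0 := by
  split_ifs with h
  · have : NeZero (Monoid.exponent A : ℂ) := ⟨by
      exact_mod_cast Monoid.exponent_ne_zero_of_finite⟩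
    simp only [h, map_one, Units.val_one, Finset.sum_const, nsmul_eq_mul, mul_one,
      Finset.card_univ, ← Nat.card_eq_fintype_card]
    rw [CommGroup.card_monoidHom_of_hasEnoughRootsOfUnity]
  · have : NeZero (Monoid.exponent A : ℂ) := ⟨by
      exact_mod_cast Monoid.exponent_ne_zero_of_finite⟩
    obtain ⟨l₀, hl₀⟩ := CommGroup.exists_apply_ne_one_of_hasEnoughRootsOfUnity A ℂ h
    have h1 : (l₀ a : ℂ) * ∑ l : A →* ℂˣ, (l a : ℂ) = ∑ l : A →* ℂˣ, (l a : ℂ) := by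
      rw [Finset.mul_sum]
      refine Fintype.sum_equiv (Equiv.mulLeft l₀) _ _ fun l => ?_
      simp
    have h2 : ((l₀ a : ℂ) - 1) * ∑ l : A →* ℂˣ, (l a : ℂ) = 0 := by
      rw [sub_mul, h1, one_mul, sub_self]
    refine (mul_eq_zero.1 h2).resolve_left fun h3 => hl₀ ?_
    exact Units.ext (sub_eq_zero.1 h3)

open scoped Pointwise in
theorem Subgroup.mem_of_mem_sup_of_odd {G : Type*} [Group G] {C P : Subgroup G} [C.Normal]
    (hP : IsPGroup 2 P) {e : G} (he : e ∈ C ⊔ P) {m : ℕ} (hm : Odd m) (hem : e ^ m = 1) :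
    e ∈ C := by
  have h1 : e ∈ (C : Set G) * (P : Set G) := by rwa [← Subgroup.normal_mul]
  obtain ⟨c, hc, p, hp, rfl⟩ := h1
  obtain ⟨k, hk⟩ := hP ⟨p, hp⟩
  have h2 : p ^ 2 ^ k = 1 := by simpa using congrArg Subtype.val hk
  have h3 : ((c * p : G) : G ⧸ C) = (p : G ⧸ C) := by
    rw [QuotientGroup.mk_mul, (QuotientGroup.eq_one_iff c).2 hc, one_mul]
  rw [← QuotientGroup.eq_one_iff]
  refine eq_one_of_pow_two_pow_of_odd (k := k) ?_ hm ?_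
  · change ((c * p : G) : G ⧸ C) ^ 2 ^ k = 1
    rw [h3, ← QuotientGroup.mk_pow, h2, QuotientGroup.mk_one]
  · change ((c * p : G) : G ⧸ C) ^ m = 1
    rw [← QuotientGroup.mk_pow, hem, QuotientGroup.mk_one]

theorem exists_odd_natCard_fixed_quotient {G : Type*} [Group G] [Finite G] (g : G) :
    ∃ (u : G) (P : Subgroup G), Odd (orderOf u) ∧ IsPGroup 2 P ∧
      P ≤ Subgroup.normalizer (Subgroup.zpowers u : Set G) ∧
      Odd (Nat.card {z : G ⧸ (Subgroup.zpowers u ⊔ P) // g • z = z}) := by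
  have : Fact (Nat.Prime 2) := ⟨Nat.prime_two⟩
  obtain ⟨k, m, hm, hgm⟩ := Nat.exists_eq_two_pow_mul_odd (orderOf_pos g).ne'
  let u := g ^ 2 ^ k
  have hum : orderOf u = m := by
    rw [orderOf_pow_of_dvd (by positivity) ⟨m, hgm⟩, hgm, Nat.mul_div_cancel_left _ (by positivity)]
  let N := Subgroup.normalizer (Subgroup.zpowers u : Set G)
  have huN : Subgroup.zpowers u ≤ N := Subgroup.le_normalizer
  let S : Sylow 2 N := default
  let P : Subgroup G := (S : Subgroup N).map N.subtype
  have hPN : P ≤ N := Subgroup.map_subtype_le _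
  let E := Subgroup.zpowers u ⊔ P
  have hE : E = ((Subgroup.zpowers u).subgroupOf N ⊔ S).map N.subtype := by
    rw [Subgroup.map_sup, Subgroup.map_subgroupOf_eq_of_le huN]
  refine ⟨u, P, hum ▸ hm, S.2.map _, hPN, ?_⟩
  -- the fixed points of `u` form an orbit of the normalizer
  have hfix : ∀ z : G ⧸ E, u • z = z ↔ z ∈ MulAction.orbit N ((1 : G) : G ⧸ E) := by
    intro z
    induction z using QuotientGroup.induction_on with
    | _ a =>
      have h1 : u • (a : G ⧸ E) = a ↔ a⁻¹ * u * a ∈ E := by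
        rw [eq_comm, MulAction.Quotient.smul_coe, smul_eq_mul, QuotientGroup.eq, mul_assoc]
      rw [h1]
      constructor
      · intro h
        have h2 : (a⁻¹ * u * a) ^ m = 1 := by
          have := conj_pow (a := a⁻¹) (b := u) (i := m)
          rw [inv_inv] at this
          rw [this, ← hum, pow_orderOf_eq_one]
          group
        rw [hE] at h
        obtain ⟨e, he, he'⟩ := h
        have h3 := Subgroup.mem_of_mem_sup_of_odd S.2 he hm (Subtype.ext (by
          rw [Subgroup.coe_pow, Subgroup.coe_one, ← h2, ← he']; rfl))
        have h4 : a⁻¹ * u * a ∈ Subgroup.zpowers u := by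
          rw [← he']
          exact h3
        have h5 : a⁻¹ ∈ N := by
          refine Subgroup.mem_normalizer_of_forall_conj_mem ?_
          rintro _ ⟨i, rfl⟩
          rw [← conj_zpow, inv_inv]
          exact Subgroup.zpow_mem _ h4 i
        refine ⟨⟨a, (inv_mem_iff).1 h5⟩, ?_⟩
        change ((a * 1 : G) : G ⧸ E) = a
        rw [mul_one]
      · rintro ⟨⟨n, hn⟩, hna⟩
        change ((n * 1 : G) : G ⧸ E) = a at hna
        rw [mul_one] at hna
        rw [← h1, ← hna, eq_comm, MulAction.Quotient.smul_coe, smul_eq_mul, QuotientGroup.eq,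
          ← mul_assoc]
        refine Subgroup.mem_sup_left ?_
        have h2 := (Subgroup.mem_normalizer_iff.1 (inv_mem hn) u).1 (Subgroup.mem_zpowers u)
        rwa [inv_inv] at h2
  have hodd : Odd (Nat.card {z : G ⧸ E // u • z = z}) := by
    rw [Nat.card_congr (Equiv.subtypeEquivRight hfix)]
    have h1 := MulAction.index_stabilizer N ((1 : G) : G ⧸ E)
    rw [← Nat.card_coe_set_eq] at h1
    change Odd (Nat.card (MulAction.orbit N ((1 : G) : G ⧸ E)))
    rw [← h1]
    have h2 : (S : Subgroup N) ≤ MulAction.stabilizer N ((1 : G) : G ⧸ E) := by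
      intro s hs
      change (((s : G) * 1 : G) : G ⧸ E) = (1 : G)
      rw [mul_one, eq_comm, QuotientGroup.eq, inv_one, one_mul]
      exact Subgroup.mem_sup_right ⟨s, hs, rfl⟩
    have h3 := S.not_dvd_index
    rw [← Nat.not_even_iff_odd, even_iff_two_dvd]
    exact fun h => h3 (h.trans (Subgroup.index_dvd_of_le h2))
  -- `g` acts on the fixed points of `u` with order a power of two
  let τ : Equiv.Perm (G ⧸ E) := MulAction.toPerm g
  have hτu : ∀ z : G ⧸ E, u • τ z = τ z ↔ u • z = z := fun z => by
    have h1 : u • g • z = g • u • z := by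
      rw [smul_smul, smul_smul, (Commute.pow_self g (2 ^ k)).eq]
    change u • g • z = g • z ↔ _
    rw [h1, smul_left_cancel_iff]
  have hτpow : τ ^ 2 ^ k = MulAction.toPerm u :=
    (map_pow (MulAction.toPermHom G (G ⧸ E)) g (2 ^ k)).symm
  have h1 : (τ.subtypePerm (p := fun z => u • z = z) hτu) ^ 2 ^ k = 1 := by
    rw [Equiv.Perm.subtypePerm_pow]
    ext z
    simp only [hτpow]
    exact z.2
  have h2 := Equiv.Perm.natCard_modEq_natCard_fixed h1
  have h3 : ∀ z : G ⧸ E, τ z = z → u • z = z := fun z hz => by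
    have h4 : (τ ^ 2 ^ k) z = z := by
      rw [Equiv.Perm.coe_pow]
      exact Function.IsFixedPt.iterate hz _
    rw [hτpow] at h4
    exact h4
  have h4 : Nat.card {z // τ.subtypePerm (p := fun z => u • z = z) hτu z = z} =
      Nat.card {z : G ⧸ E // g • z = z} :=
    (Nat.card_congr (Equiv.subtypeEquivRight fun z => Subtype.ext_iff)).trans
      (Nat.card_congr (Equiv.subtypeSubtypeEquivSubtype (q := fun z => τ z = z) (h3 _)))
  rw [h4] at h2
  rw [Nat.odd_iff] at hodd ⊢
  rw [← hodd]
  exact h2.symm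

universe u

theorem natCard_fixed_prod {G Y Z : Type*} [Group G] [MulAction G Y] [MulAction G Z] (g : G) :
    Nat.card {x : Y × Z // g • x = x} =
      Nat.card {y : Y // g • y = y} * Nat.card {z : Z // g • z = z} := by
  rw [← Nat.card_prod]
  refine Nat.card_congr ((Equiv.subtypeEquivRight fun x => ?_).trans
    (Equiv.subtypeProdEquivProd (p := fun y : Y => g • y = y) (q := fun z : Z => g • z = z)))
  rw [Prod.ext_iff]
  rfl

theorem stabilizer_quotient_ne_top {G : Type*} [Group G] {E : Subgroup G} (hE : E ≠ ⊤)
    (z : G ⧸ E) : MulAction.stabilizer G z ≠ ⊤ := by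
  induction z using QuotientGroup.induction_on with
  | _ a =>
    intro h
    refine hE ((Subgroup.eq_top_iff' E).2 fun g => ?_)
    have h1 : a * g * a⁻¹ ∈ MulAction.stabilizer G (a : G ⧸ E) := by
      rw [h]
      trivial
    rw [MulAction.mem_stabilizer_iff, eq_comm, MulAction.Quotient.smul_coe, smul_eq_mul,
      QuotientGroup.eq] at h1
    have h2 : a⁻¹ * (a * g * a⁻¹ * a) = g := by group
    rwa [h2] at h1

theorem exists_int_sum_mul_natCard_fixed {G : Type*} [Group G] [Fintype G] {χ : G → ℂ}
    (hχ : ∀ g x, χ (x * g * x⁻¹) = χ g)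
    (hprop : ∀ E : Subgroup G, E ≠ ⊤ → ∃ k : ℤ, ∑ᶠ e : E, χ e = 2 * Nat.card E * k)
    {X : Type*} [Finite X] [MulAction G X] (hX : ∀ x : X, MulAction.stabilizer G x ≠ ⊤) :
    ∃ k : ℤ, ∑ g, χ g * Nat.card {x : X // g • x = x} = 2 * Nat.card G * k := by
  classical
  have : Fintype X := Fintype.ofFinite X
  choose k hk using fun x => hprop _ (hX x)
  have hsum : ∀ x : X, ∑ᶠ e : MulAction.stabilizer G x, χ e =
      ∑ g, if g • x = x then χ g else 0 := fun x => by
    rw [finsum_eq_sum_of_fintype, ← Finset.sum_filter]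
    exact (Finset.sum_subtype _ (by simp) _).symm
  let F : X → ℤ := fun x => Nat.card (MulAction.stabilizer G x) * k x
  have hF : ∀ x, ∑ g, (if g • x = x then χ g else 0) = 2 * (F x : ℂ) := fun x => by
    rw [← hsum, hk]
    simp only [F]
    push_cast
    ring
  obtain ⟨n, hn⟩ := MulAction.card_dvd_sum_of_card_stabilizer_dvd (Γ := G) F (fun γ x => by
    have h1 : (2 : ℂ) * F (γ • x) = 2 * F x := by
      rw [← hF, ← hF]
      refine (Fintype.sum_equiv (MulAut.conj γ).toEquiv _ _ fun g => ?_).symm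
      have h2 : (γ * g * γ⁻¹) • γ • x = γ • x ↔ g • x = x := by
        rw [smul_smul, inv_mul_cancel_right, mul_smul, smul_left_cancel_iff]
      change _ = if (γ * g * γ⁻¹) • γ • x = γ • x then χ (γ * g * γ⁻¹) else 0
      simp only [h2, hχ]
    exact_mod_cast mul_left_cancel₀ two_ne_zero h1) fun x => dvd_mul_right _ _
  refine ⟨n, ?_⟩
  have h1 : ∀ g, χ g * Nat.card {x : X // g • x = x} = ∑ x : X, if g • x = x then χ g else 0 := by
    intro g
    rw [Nat.card_eq_fintype_card, Fintype.card_subtype, ← Finset.sum_filter, Finset.sum_const,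
      nsmul_eq_mul, mul_comm]
  simp only [h1]
  rw [Finset.sum_comm, Finset.sum_congr rfl fun x _ => hF x, ← Finset.mul_sum, ← Int.cast_sum, hn]
  push_cast
  ring

theorem exists_int_sum_eq_of_odd_fixed {G : Type u} [Group G] [Fintype G] {χ : G → ℂ}
    (hχ : ∀ g x, χ (x * g * x⁻¹) = χ g)
    (hprop : ∀ E : Subgroup G, E ≠ ⊤ → ∃ k : ℤ, ∑ᶠ e : E, χ e = 2 * Nat.card E * k)
    (h_int : ∃ k : ℤ, ∑ g, χ g = Nat.card G * k) (E : G → Subgroup G) (hE : ∀ g, E g ≠ ⊤)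
    (hodd : ∀ g, Odd (Nat.card {z : G ⧸ E g // g • z = z})) :
    ∃ k : ℤ, ∑ g, χ g = 2 * Nat.card G * k := by
  classical
  let π : G → G → ℤ := fun a g => Nat.card {z : G ⧸ E a // g • z = z}
  let m : G → ℤ := fun a => π a a
  have key : ∀ S : Finset G, ∀ (Y : Type u) [Finite Y] [MulAction G Y], ∃ k : ℤ,
      ∑ g, χ g * ((∏ a ∈ S, m a - ∏ a ∈ S, (m a - π a g) : ℤ) : ℂ) *
        Nat.card {y : Y // g • y = y} = 2 * Nat.card G * k := by
    intro S
    induction S using Finset.induction_on with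
    | empty => exact fun Y _ _ => ⟨0, by simp⟩
    | insert a S ha ih =>
      intro Y _ _
      obtain ⟨k₁, hk₁⟩ := ih Y
      obtain ⟨k₂, hk₂⟩ := ih (Y × G ⧸ E a)
      obtain ⟨k₃, hk₃⟩ := exists_int_sum_mul_natCard_fixed hχ hprop (X := Y × G ⧸ E a)
        fun x h => stabilizer_quotient_ne_top (hE a) x.2 (top_le_iff.1 fun g _ => by
          have h1 : g ∈ MulAction.stabilizer G x := by rw [h]; trivial
          exact congrArg Prod.snd h1)
      refine ⟨m a * k₁ + (∏ b ∈ S, m b) * k₃ - k₂, ?_⟩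
      simp only [natCard_fixed_prod] at hk₂ hk₃
      push_cast
      rw [mul_sub, mul_add, mul_left_comm, mul_left_comm _ (∏ b ∈ S, (m b : ℂ)), ← hk₁, ← hk₂,
        ← hk₃, Finset.mul_sum, Finset.mul_sum, ← Finset.sum_add_distrib,
        ← Finset.sum_sub_distrib]
      refine Finset.sum_congr rfl fun g _ => ?_
      rw [Finset.prod_insert ha, Finset.prod_insert ha]
      have h1 : ((Nat.card {z : G ⧸ E a // g • z = z} : ℕ) : ℂ) = (π a g : ℂ) := by
        simp only [π]
        push_cast
        rfl
      push_cast
      rw [h1]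
      ring
  obtain ⟨k, hk⟩ := key Finset.univ PUnit
  obtain ⟨l, hl⟩ := h_int
  have h1 : ∀ g, ∏ a, (m a - π a g) = 0 := fun g =>
    Finset.prod_eq_zero (Finset.mem_univ g) (sub_self _)
  have h2 : Nat.card {y : PUnit.{u + 1} // True} = 1 := by simp
  simp only [h1, sub_zero, h2, Nat.cast_one, mul_one, ← Finset.sum_mul, hl] at hk
  have h0 : (Nat.card G : ℂ) ≠ 0 := by exact_mod_cast Nat.card_pos.ne'
  have h3 : l * ∏ a, m a = 2 * k := by
    have : (Nat.card G : ℂ) * (l * (∏ a, m a : ℤ)) = Nat.card G * (2 * k) := by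
      rw [← mul_assoc, hk]
      ring
    exact_mod_cast mul_left_cancel₀ h0 this
  have h4 : Odd (∏ a, m a) := by
    refine Finset.prod_induction _ Odd (fun _ _ => Odd.mul) odd_one fun a _ => ?_
    exact (Int.odd_coe_nat _).2 (hodd a)
  have h5 : Even l := by
    have h6 : Even (l * ∏ a, m a) := by
      rw [h3]
      exact even_two_mul k
    exact (Int.even_mul.1 h6).resolve_right (Int.not_even_iff_odd.2 h4)
  obtain ⟨r, rfl⟩ := h5.two_dvd
  refine ⟨r, ?_⟩
  rw [hl]
  push_cast
  ring

section NormalSubgroup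

variable {G : Type*} [Group G] {C : Subgroup G} [C.Normal]

/-- The conjugation action of `G` on the linear characters of a normal subgroup. -/
noncomputable def conjChar (g : G) (l : C →* ℂˣ) : C →* ℂˣ :=
  l.comp (MulAut.conjNormal g⁻¹).toMonoidHom

theorem conjChar_apply (g : G) (l : C →* ℂˣ) (c : C) :
    conjChar g l c = l (MulAut.conjNormal g⁻¹ c) := rfl

theorem conjChar_apply_conj (g : G) (l : C →* ℂˣ) (c : C) :
    conjChar g l (MulAut.conjNormal g c) = l c := by
  rw [conjChar_apply, map_inv, MulAut.inv_apply_self]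

theorem conjChar_one (l : C →* ℂˣ) : conjChar 1 l = l := by
  ext c
  simp [conjChar_apply]

theorem conjChar_mul (g h : G) (l : C →* ℂˣ) :
    conjChar (g * h) l = conjChar g (conjChar h l) := by
  ext c
  simp only [conjChar_apply]
  rw [mul_inv_rev, map_mul, MulAut.mul_apply]

theorem conjChar_inv (g : G) (l : C →* ℂˣ) : conjChar g l⁻¹ = (conjChar g l)⁻¹ := rfl

theorem conjChar_trivial (g : G) : conjChar g (1 : C →* ℂˣ) = 1 := rfl

theorem conjChar_eq_iff {g : G} {l m : C →* ℂˣ} :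
    conjChar g l = m ↔ ∀ c, m (MulAut.conjNormal g c) = l c := by
  constructor
  · rintro rfl c
    exact conjChar_apply_conj g l c
  · intro h
    ext c
    rw [conjChar_apply, ← h, map_inv, MulAut.apply_inv_self]

variable {Q : Subgroup G}

/-- The homomorphism from the abstract semidirect product of `C` and `Q` to `G`. -/
noncomputable def semidirectToGroup (C Q : Subgroup G) [C.Normal] :
    C ⋊[(MulAut.conjNormal (H := C)).comp Q.subtype] Q →* G :=
  SemidirectProduct.lift C.subtype Q.subtype fun s => by
    ext c
    simp

/-- The linear character of the semidirect product given by a `Q`-stable character of `C`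
and a character of `Q`. -/
noncomputable def semidirectChar (l : C →* ℂˣ) (hl : ∀ s ∈ Q, conjChar s l = l) (b : Q →* ℂˣ) :
    C ⋊[(MulAut.conjNormal (H := C)).comp Q.subtype] Q →* ℂˣ :=
  SemidirectProduct.lift l b fun s => by
    ext c
    have h := conjChar_eq_iff.1 (hl s s.2) c
    simp [h]

theorem sum_semidirect [Fintype C] [Fintype Q] [Fintype
    (C ⋊[(MulAut.conjNormal (H := C)).comp Q.subtype] Q)] (χ : G → ℂ) (l : C →* ℂˣ)
    (hl : ∀ s ∈ Q, conjChar s l = l) (b : Q →* ℂˣ) :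
    ∑ h, ((semidirectChar l hl b h)⁻¹ : ℂˣ).val * χ (semidirectToGroup C Q h) =
      ∑ c : C, ∑ s : Q, ((l c)⁻¹ : ℂˣ).val * ((b s)⁻¹ : ℂˣ).val * χ (c * s) := by
  rw [← Fintype.sum_prod_type']
  refine Fintype.sum_equiv SemidirectProduct.equivProd _ _ fun h => ?_
  change ((l h.left * b h.right)⁻¹ : ℂˣ).val * χ (h.left * h.right) = _
  rw [mul_inv, Units.val_mul]
  rfl

theorem natCard_semidirect [Finite C] [Finite Q] :
    Nat.card (C ⋊[(MulAut.conjNormal (H := C)).comp Q.subtype] Q) = Nat.card C * Nat.card Q := by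
  rw [Nat.card_congr SemidirectProduct.equivProd, Nat.card_prod]

namespace IsRealVirtualCharacter

variable {χ : G → ℂ}

theorem exists_int_sum_sum (hχ : IsRealVirtualCharacter χ) [Fintype C] [Fintype Q]
    (l : C →* ℂˣ) (hl : ∀ s ∈ Q, conjChar s l = l) (b : Q →* ℂˣ) :
    ∃ k : ℤ, ∑ c : C, ∑ s : Q, ((l c)⁻¹ : ℂˣ).val * ((b s)⁻¹ : ℂˣ).val * χ (c * s) =
      Nat.card C * Nat.card Q * k := by
  let _ : Fintype (C ⋊[(MulAut.conjNormal (H := C)).comp Q.subtype] Q) :=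
    Fintype.ofEquiv _ SemidirectProduct.equivProd.symm
  rw [← sum_semidirect χ l hl b, ← Nat.cast_mul, ← natCard_semidirect]
  exact hχ.exists_int_sum _ _

theorem exists_even_sum_sum (hχ : IsRealVirtualCharacter χ) [Fintype C] [Fintype Q]
    (l : C →* ℂˣ) (hl : ∀ s ∈ Q, conjChar s l = l) (b : Q →* ℂˣ) (x : G) (hxx : x * x ∈ Q)
    (hxl : conjChar x l = l⁻¹) (hxQ : ∀ s ∈ Q, Commute x s) (hb : ∀ s, b s = (b s)⁻¹)
    (hbx : b ⟨x * x, hxx⟩ = -1) :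
    ∃ k : ℤ, Even k ∧
      ∑ c : C, ∑ s : Q, ((l c)⁻¹ : ℂˣ).val * ((b s)⁻¹ : ℂˣ).val * χ (c * s) =
        Nat.card C * Nat.card Q * k := by
  let _ : Fintype (C ⋊[(MulAut.conjNormal (H := C)).comp Q.subtype] Q) :=
    Fintype.ofEquiv _ SemidirectProduct.equivProd.symm
  rw [← sum_semidirect χ l hl b, ← Nat.cast_mul, ← natCard_semidirect]
  refine hχ.exists_even_sum _ _ x (fun h => ⟨⟨MulAut.conjNormal x⁻¹ h.left, h.right⟩, ?_, ?_⟩)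
    ⟨1, ⟨x * x, hxx⟩⟩ ?_ ?_
  · change x * ((MulAut.conjNormal x⁻¹ h.left : C) * h.right : G) = h.left * h.right * x
    rw [MulAut.conjNormal_apply, inv_inv, mul_assoc (h.left : G), ← (hxQ _ h.right.2).eq]
    group
  · change l h.left * b h.right = (l (MulAut.conjNormal x⁻¹ h.left) * b h.right)⁻¹
    rw [mul_inv, ← hb, ← conjChar_apply, hxl, MonoidHom.inv_apply, inv_inv]
  · change ((1 : C) : G) * (x * x) = x * x
    simp
  · change l 1 * b ⟨x * x, hxx⟩ = -1
    rw [map_one, one_mul, hbx]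

end IsRealVirtualCharacter

end NormalSubgroup

section CharacterSums

theorem sum_unitsHom_sum_eq_zero_of_vanishing {A : Type*} [CommGroup A] [Fintype A]
    [Fintype (A →* ℂˣ)] (Z : Subgroup A) (F : A → ℂ) (hF : ∀ z ∈ Z, F z = 0) (l : A →* ℂˣ)
    [∀ l' : A →* ℂˣ, Decidable (∀ z ∈ Z, l' z = l z)] :
    ∑ l' : A →* ℂˣ, (if ∀ z ∈ Z, l' z = l z then ∑ c, ((l' c)⁻¹ : ℂˣ).val * F c else 0) = 0 := by
  classical
  have h1 : ∀ l' : A →* ℂˣ, ∑ z : Z, (l' z : ℂ) * ((l z)⁻¹ : ℂˣ).val =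
      if ∀ z ∈ Z, l' z = l z then (Nat.card Z : ℂ) else 0 := by
    intro l'
    let ν : Z →* ℂ := (Units.coeHom ℂ).comp ((l' * l⁻¹).comp Z.subtype)
    have h2 := sum_hom_units ν
    have h3 : ν = 1 ↔ ∀ z ∈ Z, l' z = l z := by
      rw [MonoidHom.ext_iff]
      constructor
      · intro h z hz
        have h4 : l' z * (l z)⁻¹ = 1 := Units.ext (h ⟨z, hz⟩)
        exact mul_inv_eq_one.1 h4
      · intro h z
        change ((l' z * (l z)⁻¹ : ℂˣ) : ℂ) = 1
        rw [h z z.2, mul_inv_cancel, Units.val_one]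
    simp only [h3] at h2
    rw [Nat.cast_ite, Nat.cast_zero] at h2
    rw [Nat.card_eq_fintype_card, ← h2]
    rfl
  have h0 : (Nat.card Z : ℂ) ≠ 0 := by exact_mod_cast Nat.card_pos.ne'
  refine (mul_eq_zero.1 ?_).resolve_left h0
  have h2 : ∀ l' : A →* ℂˣ, (Nat.card Z : ℂ) *
      (if ∀ z ∈ Z, l' z = l z then ∑ c, ((l' c)⁻¹ : ℂˣ).val * F c else 0) =
      ∑ z : Z, ∑ c, ((l z)⁻¹ : ℂˣ).val * F c * (l' (z * c⁻¹) : ℂ) := by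
    intro l'
    have h3 : (Nat.card Z : ℂ) *
        (if ∀ z ∈ Z, l' z = l z then ∑ c, ((l' c)⁻¹ : ℂˣ).val * F c else 0) =
        (if ∀ z ∈ Z, l' z = l z then (Nat.card Z : ℂ) else 0) *
          ∑ c, ((l' c)⁻¹ : ℂˣ).val * F c := by
      split_ifs <;> simp
    rw [h3, ← h1, Finset.sum_mul_sum]
    refine Finset.sum_congr rfl fun z _ => Finset.sum_congr rfl fun c _ => ?_
    rw [map_mul, map_inv, Units.val_mul]
    ring
  rw [Finset.mul_sum, Finset.sum_congr rfl fun l' _ => h2 l', Finset.sum_comm]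
  refine Finset.sum_eq_zero fun z _ => ?_
  rw [Finset.sum_comm]
  refine Finset.sum_eq_zero fun c _ => ?_
  rw [← Finset.mul_sum, sum_unitsHom_apply]
  split_ifs with h
  · rw [← mul_inv_eq_one.1 h, hF z z.2]
    simp
  · simp

theorem unitsHom_eq_one_of_trivial_on_primary {A M : Type*} [CommGroup A] [Finite A]
    [CommGroup M] {q : ℕ} [hq : Fact q.Prime] {ν : A →* M} {b : ℕ} (hν : ν ^ q ^ b = 1)
    (h : ∀ z ∈ CommGroup.primaryComponent A q, ν z = 1) : ν = 1 := by
  obtain ⟨N, m, hm, hA⟩ := Nat.exists_eq_pow_mul_and_not_dvd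
    (n := Nat.card A) Nat.card_pos.ne' q hq.out.ne_one
  ext a
  have h1 : a ^ m ∈ CommGroup.primaryComponent A q := by
    exact ⟨N, by rw [← pow_mul, mul_comm, ← hA, pow_card_eq_one']⟩
  have h2 : ν a ^ m = 1 := by rw [← map_pow, h _ h1]
  have h3 : ν a ^ q ^ b = 1 := by rw [← MonoidHom.pow_apply, hν, MonoidHom.one_apply]
  have h4 : Nat.Coprime (q ^ b) m :=
    Nat.Coprime.pow_left _ ((Nat.Prime.coprime_iff_not_dvd hq.out).2 hm)
  have h5 : orderOf (ν a) ∣ Nat.gcd (q ^ b) m :=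
    Nat.dvd_gcd (orderOf_dvd_of_pow_eq_one h3) (orderOf_dvd_of_pow_eq_one h2)
  rwa [h4, Nat.dvd_one, orderOf_eq_one_iff] at h5

variable {G : Type*} [Group G] {C : Subgroup G} {χ : G → ℂ}

/-- The (unnormalised) multiplicity of the character `l` of `C` in `χ (· * s)`. -/
noncomputable def charCoeff [Fintype C] (χ : G → ℂ) (l : C →* ℂˣ) (s : G) : ℂ :=
  ∑ c : C, ((l c)⁻¹ : ℂˣ).val * χ (c * s)

theorem charCoeff_inv [Finite G] [Fintype C] (hχ : ∀ g, conj (χ g) = χ g) (l : C →* ℂˣ) (s : G) :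
    charCoeff χ l⁻¹ s = conj (charCoeff χ l s) := by
  unfold charCoeff
  rw [map_sum]
  refine Finset.sum_congr rfl fun c _ => ?_
  rw [map_mul, hχ, MonoidHom.inv_apply, inv_inv, ← MonoidHom.inv_apply,
    Complex.conj_unitsHom_apply, MonoidHom.inv_apply, inv_inv]

variable [C.Normal]

theorem charCoeff_conjChar [Fintype C] (hχ : ∀ g x, χ (x * g * x⁻¹) = χ g) (p : G)
    (l : C →* ℂˣ) (s : G) : charCoeff χ (conjChar p l) s = charCoeff χ l (p⁻¹ * s * p) := by
  symm
  refine Fintype.sum_equiv (MulAut.conjNormal p).toEquiv _ _ fun c => ?_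
  change _ = ((conjChar p l (MulAut.conjNormal p c))⁻¹ : ℂˣ).val *
    χ ((MulAut.conjNormal p c : C) * s)
  rw [conjChar_apply_conj, ← hχ _ p, MulAut.conjNormal_apply]
  congr 2
  group

theorem charCoeff_eq_zero_of_conjChar_ne [Fintype C] (hχ : ∀ g x, χ (x * g * x⁻¹) = χ g)
    {l : C →* ℂˣ} {s : G} (hs : conjChar s l ≠ l) : charCoeff χ l s = 0 := by
  unfold charCoeff
  obtain ⟨c₀, hc₀⟩ : ∃ c₀, l (MulAut.conjNormal s c₀) ≠ l c₀ := by
    by_contra! h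
    exact hs (conjChar_eq_iff.2 h)
  have h1 : ∑ c : C, ((l c)⁻¹ : ℂˣ).val * χ (c * s) =
      (((l c₀)⁻¹ * l (MulAut.conjNormal s c₀) : ℂˣ) : ℂ) *
        ∑ c : C, ((l c)⁻¹ : ℂˣ).val * χ (c * s) := by
    rw [Finset.mul_sum]
    symm
    refine Fintype.sum_equiv
      ((Equiv.mulLeft c₀).trans (Equiv.mulRight (MulAut.conjNormal s c₀)⁻¹)) _ _ fun c => ?_
    change _ = ((l (c₀ * c * (MulAut.conjNormal s c₀)⁻¹))⁻¹ : ℂˣ).val *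
      χ ((c₀ * c * (MulAut.conjNormal s c₀)⁻¹ : C) * s)
    have h2 : ((c₀ * c * (MulAut.conjNormal s c₀)⁻¹ : C) * s : G) =
        c₀ * (c * s) * (c₀ : G)⁻¹ := by
      rw [Subgroup.coe_mul, Subgroup.coe_inv, MulAut.conjNormal_apply, Subgroup.coe_mul]
      group
    rw [h2, hχ, ← mul_assoc, ← Units.val_mul]
    congr 2
    rw [map_mul, map_mul, map_inv, mul_inv, mul_inv, inv_inv]
    exact mul_right_comm _ _ _
  have h2 : ((((l c₀)⁻¹ * l (MulAut.conjNormal s c₀) : ℂˣ) : ℂ) - 1) *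
      ∑ c : C, ((l c)⁻¹ : ℂˣ).val * χ (c * s) = 0 := by
    rw [sub_mul, ← h1, one_mul, sub_self]
  refine (mul_eq_zero.1 h2).resolve_left fun h3 => hc₀ ?_
  exact (inv_mul_eq_one.1 (Units.ext (sub_eq_zero.1 h3))).symm

end CharacterSums

section CyclicNormal

variable {G : Type*} [Group G] {u : G} {l : Subgroup.zpowers u →* ℂˣ}

theorem unitsHom_eq_one_of_apply_generator
    (h : l ⟨u, Subgroup.mem_zpowers u⟩ = 1) : l = 1 := by
  ext ⟨c, hc⟩
  obtain ⟨i, rfl⟩ := Subgroup.mem_zpowers_iff.1 hc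
  have h1 : (⟨u ^ i, hc⟩ : Subgroup.zpowers u) = ⟨u, Subgroup.mem_zpowers u⟩ ^ i := rfl
  rw [h1, map_zpow, h, one_zpow, MonoidHom.one_apply]

theorem pow_orderOf_apply_generator (l : Subgroup.zpowers u →* ℂˣ) :
    l ^ orderOf (l ⟨u, Subgroup.mem_zpowers u⟩) = 1 :=
  unitsHom_eq_one_of_apply_generator (by rw [MonoidHom.pow_apply, pow_orderOf_eq_one])

theorem orderOf_apply_generator_dvd (l : Subgroup.zpowers u →* ℂˣ) :
    orderOf (l ⟨u, Subgroup.mem_zpowers u⟩) ∣ orderOf u := by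
  have h := orderOf_map_dvd l ⟨u, Subgroup.mem_zpowers u⟩
  rwa [Subgroup.orderOf_mk] at h

theorem unitsHom_eq_one_of_inv_eq (hu : Odd (orderOf u)) (h : l⁻¹ = l) : l = 1 := by
  refine unitsHom_eq_one_of_apply_generator ?_
  have h1 := DFunLike.congr_fun h ⟨u, Subgroup.mem_zpowers u⟩
  rw [MonoidHom.inv_apply] at h1
  refine eq_one_of_pow_two_pow_of_odd (k := 1) ?_ (hu.of_dvd_nat (orderOf_apply_generator_dvd l))
    (pow_orderOf_eq_one _)
  rw [pow_one, pow_two]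
  nth_rewrite 1 [← h1]
  exact inv_mul_cancel _

variable [Finite G] [(Subgroup.zpowers u).Normal]

theorem exists_orderOf_conj_eq_zpow {d : ℕ}
    (hd : d ∣ orderOf (l ⟨u, Subgroup.mem_zpowers u⟩)) :
    ∃ c : G, orderOf c = d ∧ ∀ (g : G) (ε : ℤ), ε * ε = 1 → (∀ z, conjChar g l z = l z ^ ε) →
      g * c * g⁻¹ = c ^ ε := by
  obtain ⟨e, he⟩ := hd.trans (orderOf_apply_generator_dvd l)
  have hpos := orderOf_pos u
  have he0 : e ≠ 0 := by
    rintro rfl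
    rw [mul_zero] at he
    omega
  have hc : orderOf (u ^ e) = d := by
    rw [orderOf_pow_of_dvd he0 ⟨d, by rw [he, mul_comm]⟩, he,
      Nat.mul_div_cancel _ (Nat.pos_of_ne_zero he0)]
  refine ⟨u ^ e, hc, fun g ε hε hg => ?_⟩
  obtain ⟨s, hs⟩ : ∃ s : ℤ, u ^ s = g * u * g⁻¹ :=
    Subgroup.mem_zpowers_iff.1
      (Subgroup.Normal.conj_mem inferInstance u (Subgroup.mem_zpowers u) g)
  have h1 : l ⟨u, Subgroup.mem_zpowers u⟩ ^ (s * ε) = l ⟨u, Subgroup.mem_zpowers u⟩ := by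
    have h2 := hg (MulAut.conjNormal g ⟨u, Subgroup.mem_zpowers u⟩)
    have h3 : MulAut.conjNormal g (⟨u, Subgroup.mem_zpowers u⟩ : Subgroup.zpowers u) =
        ⟨u, Subgroup.mem_zpowers u⟩ ^ s := by
      ext
      rw [MulAut.conjNormal_apply, Subgroup.coe_zpow, hs]
    rw [conjChar_apply_conj, h3, map_zpow, ← zpow_mul] at h2
    exact h2.symm
  have h4 : (d : ℤ) ∣ s - ε := by
    have h5 : l ⟨u, Subgroup.mem_zpowers u⟩ ^ (s * ε - 1) = 1 := by
      rw [zpow_sub_one, h1, mul_inv_cancel]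
    have h6 : (d : ℤ) ∣ s * ε - 1 :=
      (Int.natCast_dvd_natCast.2 hd).trans (orderOf_dvd_iff_zpow_eq_one.2 h5)
    have h7 : s - ε = (s * ε - 1) * ε := by
      linear_combination (-s) * hε
    exact h7 ▸ h6.mul_right ε
  have h8 : g * u ^ e * g⁻¹ = (u ^ e) ^ s := by
    rw [← conj_pow, ← hs, ← zpow_natCast, ← zpow_natCast, ← zpow_mul, ← zpow_mul, mul_comm]
  rw [h8]
  exact zpow_eq_zpow_iff_modEq.2 ((Int.modEq_iff_dvd.2 (by rwa [hc])).symm)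

/-- A nontrivial character of odd order inverted by a `2`-element has prime power order. -/
theorem exists_prime_pow_eq_one_of_inverted (hG : ¬HasDihedralSubquotient G)
    (hu : Odd (orderOf u)) (hl : l ≠ 1) {t : G} {k : ℕ} (ht : t ^ 2 ^ k = 1)
    (htl : conjChar t l = l⁻¹) :
    ∃ q, q.Prime ∧ q ≠ 2 ∧ q ∣ orderOf (l ⟨u, Subgroup.mem_zpowers u⟩) ∧
      ∃ b, l ^ q ^ b = 1 := by
  have h1 : orderOf (l ⟨u, Subgroup.mem_zpowers u⟩) ≠ 1 := fun h =>
    hl (unitsHom_eq_one_of_apply_generator (orderOf_eq_one_iff.1 h))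
  have h0 : orderOf (l ⟨u, Subgroup.mem_zpowers u⟩) ≠ 0 := fun h => by
    have := orderOf_apply_generator_dvd l
    rw [h, zero_dvd_iff] at this
    exact (orderOf_pos u).ne' this
  have hodd : Odd (orderOf (l ⟨u, Subgroup.mem_zpowers u⟩)) :=
    hu.of_dvd_nat (orderOf_apply_generator_dvd l)
  obtain ⟨q, hq, hqd⟩ := Nat.exists_prime_and_dvd h1
  refine ⟨q, hq, ?_, hqd, (orderOf (l ⟨u, Subgroup.mem_zpowers u⟩)).primeFactorsList.length, ?_⟩
  · rintro rfl
    exact absurd (hodd.of_dvd_nat hqd) (by decide)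
  · rw [← Nat.eq_prime_pow_of_unique_prime_dvd h0, pow_orderOf_apply_generator]
    intro p hp hpd
    by_contra hpq
    have hdvd := Nat.Coprime.mul_dvd_of_dvd_of_dvd ((Nat.coprime_primes hp hq).2 hpq) hpd hqd
    obtain ⟨c, hc, hcg⟩ := exists_orderOf_conj_eq_zpow hdvd
    have htc := hcg t (-1) (by norm_num) fun z => by rw [htl, zpow_neg_one, MonoidHom.inv_apply]
    exact hG (hasDihedralSubquotient_of_odd_order_inverted hp hq hpq (hodd.of_dvd_nat hdvd) hc ht
      (by rw [htc, zpow_neg_one]))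

end CyclicNormal

section CyclicNormal

open scoped IsMulCommutative

/-- The conjugation action on the linear characters of a normal subgroup, as permutations. -/
noncomputable def conjCharPerm {G : Type*} [Group G] (C : Subgroup G) [C.Normal] :
    G →* Equiv.Perm (C →* ℂˣ) where
  toFun g := ⟨conjChar g, conjChar g⁻¹,
    fun l => by rw [← conjChar_mul, inv_mul_cancel, conjChar_one],
    fun l => by rw [← conjChar_mul, mul_inv_cancel, conjChar_one]⟩
  map_one' := Equiv.ext conjChar_one
  map_mul' g h := Equiv.ext (conjChar_mul g h)

theorem unitsHom_inv_inv {A : Type*} [Group A] (l : A →* ℂˣ) : l⁻¹⁻¹ = l :=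
  inv_inv l

theorem IsRealVirtualCharacter.exists_int_charCoeff {G : Type*} [Group G] {C : Subgroup G}
    [Fintype C] {χ : G → ℂ} (hχ : IsRealVirtualCharacter χ) (l : C →* ℂˣ) :
    ∃ d : ℤ, charCoeff χ l 1 = Nat.card C * d := by
  obtain ⟨d, hd⟩ := hχ.exists_int_sum C.subtype l
  refine ⟨d, hd ▸ Finset.sum_congr rfl fun c _ => ?_⟩
  rw [mul_one]
  rfl

variable {G : Type*} [Group G] [Finite G] {u : G} [(Subgroup.zpowers u).Normal]
  {l : Subgroup.zpowers u →* ℂˣ} {χ : G → ℂ}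


theorem IsRealVirtualCharacter.exists_even_charCoeff [Fintype (Subgroup.zpowers u)]
    (hχ : IsRealVirtualCharacter χ) (hvan : ∀ g p k, p.Prime → g ^ p ^ k = 1 → χ g = 0)
    (hG : ¬HasDihedralSubquotient G) (hu : Odd (orderOf u)) (hl : l ≠ 1) {t : G} {k : ℕ}
    (ht : t ^ 2 ^ k = 1) (htl : conjChar t l = l⁻¹) :
    ∃ d : ℤ, Even d ∧ charCoeff χ l 1 = Nat.card (Subgroup.zpowers u) * d := by
  classical
  have hC0 : (Nat.card (Subgroup.zpowers u) : ℂ) ≠ 0 := by exact_mod_cast Nat.card_pos.ne'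
  choose d hd using hχ.exists_int_charCoeff (C := Subgroup.zpowers u)
  refine ⟨d l, ?_, hd l⟩
  let _ : Fintype (Subgroup.zpowers u →* ℂˣ) := Fintype.ofFinite _
  obtain ⟨q, hq, hq2, hqd, b, hb⟩ := exists_prime_pow_eq_one_of_inverted hG hu hl ht htl
  have := Fact.mk hq
  let Z := CommGroup.primaryComponent (Subgroup.zpowers u) q
  have hZ : ∀ g : G, ∀ z ∈ Z, MulAut.conjNormal g z ∈ Z := by
    rintro g z ⟨i, hi⟩
    exact ⟨i, by rw [← map_pow, hi, map_one]⟩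
  have hlZ : ∃ z ∈ Z, l z ≠ 1 := by
    by_contra! h
    exact hl (unitsHom_eq_one_of_trivial_on_primary hb h)
  have hsum : ∑ l' : Subgroup.zpowers u →* ℂˣ, (if ∀ z ∈ Z, l' z = l z then d l' else 0) = 0 := by
    have h := sum_unitsHom_sum_eq_zero_of_vanishing Z (fun c => χ c) (by
      rintro z ⟨i, hi⟩
      exact hvan _ q i hq (by exact_mod_cast congrArg Subtype.val hi)) l
    have h1 : ∀ l' : Subgroup.zpowers u →* ℂˣ,
        (if ∀ z ∈ Z, l' z = l z then ∑ c, ((l' c)⁻¹ : ℂˣ).val * χ c else 0) =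
        Nat.card (Subgroup.zpowers u) * ((if ∀ z ∈ Z, l' z = l z then d l' else 0 : ℤ) : ℂ) := by
      intro l'
      split_ifs
      · rw [← hd, charCoeff]
        simp only [mul_one]
      · simp
    rw [Finset.sum_congr rfl fun l' _ => h1 l', ← Finset.mul_sum] at h
    exact_mod_cast (mul_eq_zero.1 h).resolve_left hC0
  let σ : Equiv.Perm (Subgroup.zpowers u →* ℂˣ) := conjCharPerm _ t * Equiv.inv _
  have hσ : ∀ l', σ l' = (conjChar t l')⁻¹ := fun l' => conjChar_inv t l'
  have hσpow : σ ^ 2 ^ (k + 1) = 1 := by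
    have h1 : Commute (conjCharPerm (Subgroup.zpowers u) t)
      (Equiv.inv (Subgroup.zpowers u →* ℂˣ)) := Equiv.ext fun l' => conjChar_inv t l'
    have h2 : (Equiv.inv (Subgroup.zpowers u →* ℂˣ)) ^ 2 = 1 := Equiv.ext fun l' => inv_inv l'
    change (conjCharPerm _ t * Equiv.inv _) ^ 2 ^ (k + 1) = 1
    rw [h1.mul_pow, ← map_pow, pow_succ, pow_mul, ht, one_pow, map_one, one_mul, mul_comm,
      pow_mul, h2, one_pow]
  have hdσ : ∀ l', d (σ l') = d l' := by
    intro l'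
    have h1 : (Nat.card (Subgroup.zpowers u) : ℂ) * d (σ l') =
        Nat.card (Subgroup.zpowers u) * d l' := by
      rw [← hd, hσ, charCoeff_inv hχ.conj_apply, charCoeff_conjChar fun g x => hχ.apply_conj g x,
        mul_one, inv_mul_cancel, hd]
      simp
    exact_mod_cast mul_left_cancel₀ hC0 h1
  have hagree : ∀ l', (∀ z ∈ Z, σ l' z = l z) ↔ ∀ z ∈ Z, l' z = l z := by
    intro l'
    have h1 : l = (conjChar t l)⁻¹ := by rw [htl, unitsHom_inv_inv]
    rw [hσ]
    constructor
    · intro h z hz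
      have h2 := h _ (hZ t z hz)
      rwa [h1, MonoidHom.inv_apply, MonoidHom.inv_apply, inv_inj, conjChar_apply_conj,
        conjChar_apply_conj] at h2
    · intro h z hz
      rw [h1, MonoidHom.inv_apply, MonoidHom.inv_apply, conjChar_apply, conjChar_apply,
        h _ (hZ t⁻¹ z hz)]
  have hfix : σ l = l := by rw [hσ, htl, unitsHom_inv_inv]
  have key := Equiv.Perm.even_sum_sub_of_even_of_fixed (σ := σ) (k := k + 1)
    (f := fun l' => if ∀ z ∈ Z, l' z = l z then d l' else 0) (i₀ := l) hσpow
    (fun l' => by simp only [hagree, hdσ]) hfix ?_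
  · rw [hsum, if_pos fun z _ => rfl, zero_sub, even_neg] at key
    exact key
  · intro l' hl' hne
    split_ifs with hag
    · exfalso
      obtain ⟨z, hz, hlz⟩ := hlZ
      have hl1 : l' ≠ 1 := by
        rintro rfl
        exact hlz (hag z hz).symm
      have hinv : conjChar t l' = l'⁻¹ := by rw [← unitsHom_inv_inv (conjChar t l'), ← hσ, hl']
      obtain ⟨r, hr, -, -, b', hb'⟩ := exists_prime_pow_eq_one_of_inverted hG hu hl1 ht hinv
      have hrq : r = q := by
        by_contra hrq
        have h1 : l z ^ q ^ b = 1 := by rw [← MonoidHom.pow_apply, hb, MonoidHom.one_apply]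
        have h2 : l z ^ r ^ b' = 1 := by
          rw [← hag z hz, ← MonoidHom.pow_apply, hb', MonoidHom.one_apply]
        have h3 : Nat.Coprime (q ^ b) (r ^ b') :=
          Nat.Coprime.pow _ _ ((Nat.coprime_primes hq hr).2 (Ne.symm hrq))
        have h4 := Nat.dvd_gcd (orderOf_dvd_of_pow_eq_one h1) (orderOf_dvd_of_pow_eq_one h2)
        rw [h3, Nat.dvd_one, orderOf_eq_one_iff] at h4
        exact hlz h4
      subst hrq
      have h5 : l' * l⁻¹ = 1 := by
        refine unitsHom_eq_one_of_trivial_on_primary (q := r) (b := b + b') ?_ ?_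
        · rw [mul_pow, inv_pow]
          nth_rewrite 1 [add_comm]
          rw [pow_add, pow_mul, hb', one_pow, pow_add, pow_mul, hb, one_pow, inv_one, one_mul]
        · intro z hz
          rw [MonoidHom.mul_apply, MonoidHom.inv_apply, hag z hz, mul_inv_cancel]
      exact hne (mul_inv_eq_one.1 h5)
    · exact Even.zero

end CyclicNormal

section CyclicNormal

open scoped IsMulCommutative

variable {G : Type*} [Group G] [Finite G] {u : G} [(Subgroup.zpowers u).Normal]
  {l : Subgroup.zpowers u →* ℂˣ} {χ : G → ℂ} {P Q : Subgroup G}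

/-- If `l` is inverted by `t`, its stabilizer in a `2`-subgroup is generated by `t * t`. -/
theorem eq_zpowers_of_mem_iff_conjChar_eq (hG : ¬HasDihedralSubquotient G)
    (hu : Odd (orderOf u)) (hP : IsPGroup 2 P) (hl : l ≠ 1)
    (hQ : ∀ s, s ∈ Q ↔ s ∈ P ∧ conjChar s l = l) {t : G} (htP : t ∈ P)
    (htl : conjChar t l = l⁻¹) : Q = Subgroup.zpowers (t * t) := by
  have htt : t * t ∈ Q := (hQ _).2 ⟨mul_mem htP htP, by
    rw [conjChar_mul, htl, conjChar_inv, htl, unitsHom_inv_inv]⟩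
  let R : Subgroup G :=
    { carrier := {g | g ∈ P ∧ (conjChar g l = l ∨ conjChar g l = l⁻¹)}
      one_mem' := ⟨one_mem P, Or.inl (conjChar_one l)⟩
      mul_mem' := by
        rintro a b ⟨ha, ha'⟩ ⟨hb, hb'⟩
        refine ⟨mul_mem ha hb, ?_⟩
        rw [conjChar_mul]
        rcases ha' with ha' | ha' <;> rcases hb' with hb' | hb' <;>
          simp only [hb', ha', conjChar_inv, unitsHom_inv_inv, true_or, or_true]
      inv_mem' := by
        rintro a ⟨ha, ha'⟩
        refine ⟨inv_mem ha, ?_⟩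
        have h : conjChar a⁻¹ (conjChar a l) = l := by
          rw [← conjChar_mul, inv_mul_cancel, conjChar_one]
        rcases ha' with ha' | ha'
        · exact Or.inl (by rwa [ha'] at h)
        · right
          rw [ha', conjChar_inv] at h
          rw [← h, unitsHom_inv_inv, h] }
  have hRz : Subgroup.zpowers t = R := by
    by_contra hne
    obtain ⟨k, hk⟩ := hP ⟨t, htP⟩
    obtain ⟨q, hq, hq2, hqd, -⟩ := exists_prime_pow_eq_one_of_inverted hG hu hl
      (k := k) (by simpa using congrArg Subtype.val hk) htl
    obtain ⟨c, hc, hcg⟩ := exists_orderOf_conj_eq_zpow hqd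
    have hinv : ∀ g, conjChar g l = l⁻¹ → g * c * g⁻¹ = c⁻¹ := fun g hg => by
      rw [hcg g (-1) (by norm_num) fun z => by rw [hg, zpow_neg_one, MonoidHom.inv_apply],
        zpow_neg_one]
    refine hG (hasDihedralSubquotient_of_two_group_inverting hq hq2 hc (R := R)
      (hP.to_le fun g hg => hg.1) ?_ ⟨htP, Or.inr htl⟩ (hinv t htl) hne)
    rintro g ⟨-, hg | hg⟩
    · left
      rw [hcg g 1 (by norm_num) fun z => by rw [hg, zpow_one], zpow_one]
    · exact Or.inr (hinv g hg)
  refine le_antisymm (fun s hs => ?_) (by rwa [Subgroup.zpowers_le])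
  obtain ⟨hsP, hsl⟩ := (hQ s).1 hs
  have hsR : s ∈ Subgroup.zpowers t := by
    rw [hRz]
    exact ⟨hsP, Or.inl hsl⟩
  obtain ⟨i, rfl⟩ := Subgroup.mem_zpowers_iff.1 hsR
  rcases Int.even_or_odd' i with ⟨j, rfl | rfl⟩
  · exact Subgroup.mem_zpowers_iff.2 ⟨j, by rw [zpow_mul, zpow_two]⟩
  · exfalso
    have h1 : t ^ (2 * j + 1) = t * (t * t) ^ j := by
      rw [add_comm, zpow_add, zpow_one, zpow_mul, zpow_two]
    rw [h1, conjChar_mul, ((hQ _).1 (zpow_mem htt j)).2, htl] at hsl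
    exact hl (unitsHom_eq_one_of_inv_eq hu hsl)

theorem IsRealVirtualCharacter.exists_even_sum_charCoeff [Fintype (Subgroup.zpowers u)]
    [Fintype Q] (hχ : IsRealVirtualCharacter χ)
    (hvan : ∀ g p k, p.Prime → g ^ p ^ k = 1 → χ g = 0)
    (hG : ¬HasDihedralSubquotient G) (hu : Odd (orderOf u)) (hP : IsPGroup 2 P) (hl : l ≠ 1)
    (hQ : ∀ s, s ∈ Q ↔ s ∈ P ∧ conjChar s l = l) {t : G} (htP : t ∈ P)
    (htl : conjChar t l = l⁻¹) :
    ∃ n : ℤ, Even n ∧ ∑ s : Q, charCoeff χ l s =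
      Nat.card (Subgroup.zpowers u) * Nat.card Q * n := by
  classical
  have hQz := eq_zpowers_of_mem_iff_conjChar_eq hG hu hP hl hQ htP htl
  subst hQz
  have hlQ : ∀ s ∈ Subgroup.zpowers (t * t), conjChar s l = l := fun s hs => ((hQ s).1 hs).2
  have hcomm : ∀ s ∈ Subgroup.zpowers (t * t), Commute t s := fun s hs => by
    obtain ⟨i, rfl⟩ := Subgroup.mem_zpowers_iff.1 hs
    exact ((Commute.refl t).mul_right (Commute.refl t)).zpow_right i
  have hC0 : (Nat.card (Subgroup.zpowers u) : ℂ) ≠ 0 := by exact_mod_cast Nat.card_pos.ne'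
  have hQ0 : (Nat.card (Subgroup.zpowers (t * t)) : ℂ) ≠ 0 := by exact_mod_cast Nat.card_pos.ne'
  let _ : Fintype (Subgroup.zpowers (t * t) →* ℂˣ) := Fintype.ofFinite _
  have hswap : ∀ b : Subgroup.zpowers (t * t) →* ℂˣ,
      ∑ c : Subgroup.zpowers u, ∑ s : Subgroup.zpowers (t * t),
        ((l c)⁻¹ : ℂˣ).val * ((b s)⁻¹ : ℂˣ).val * χ (c * s) =
      ∑ s : Subgroup.zpowers (t * t), ((b s)⁻¹ : ℂˣ).val * charCoeff χ l s := by
    intro b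
    rw [Finset.sum_comm]
    refine Finset.sum_congr rfl fun s _ => ?_
    rw [charCoeff, Finset.mul_sum]
    exact Finset.sum_congr rfl fun c _ => by ring
  choose n hn using fun b => hχ.exists_int_sum_sum l hlQ b
  simp only [hswap] at hn
  refine ⟨n 1, ?_, ?_⟩
  swap
  · rw [← hn]
    simp
  obtain ⟨k, hk⟩ := hP ⟨t, htP⟩
  obtain ⟨d, hd, hdl⟩ := hχ.exists_even_charCoeff hvan hG hu hl (k := k)
    (by simpa using congrArg Subtype.val hk) htl
  have hsum : ∑ b, n b = d := by
    have h1 : (Nat.card (Subgroup.zpowers u) * Nat.card (Subgroup.zpowers (t * t)) : ℂ) *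
        ∑ b, (n b : ℂ) = Nat.card (Subgroup.zpowers u) *
          Nat.card (Subgroup.zpowers (t * t)) * d := by
      rw [Finset.mul_sum, Finset.sum_congr rfl fun b _ => (hn b).symm, Finset.sum_comm]
      have h2 : ∀ s : Subgroup.zpowers (t * t),
          ∑ b : Subgroup.zpowers (t * t) →* ℂˣ, ((b s)⁻¹ : ℂˣ).val * charCoeff χ l s =
          if s = 1 then Nat.card (Subgroup.zpowers (t * t)) * charCoeff χ l 1 else 0 := by
        intro s
        have h3 := sum_unitsHom_apply s⁻¹
        simp only [map_inv, inv_eq_one] at h3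
        rw [← Finset.sum_mul, h3]
        split_ifs with hs
        · rw [hs, Subgroup.coe_one]
        · rw [zero_mul]
      rw [Finset.sum_congr rfl fun s _ => h2 s, Finset.sum_ite_eq' Finset.univ]
      simp only [Finset.mem_univ, if_true]
      rw [hdl]
      ring
    exact_mod_cast mul_left_cancel₀ (mul_ne_zero hC0 hQ0) h1
  have hninv : ∀ b, n b⁻¹ = n b := by
    intro b
    have h1 : (Nat.card (Subgroup.zpowers u) * Nat.card (Subgroup.zpowers (t * t)) : ℂ) *
        n b⁻¹ = Nat.card (Subgroup.zpowers u) * Nat.card (Subgroup.zpowers (t * t)) * n b := by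
      have h2 := congrArg (starRingEnd ℂ) (hn b)
      simp only [map_sum, map_mul, Complex.conj_natCast, map_intCast] at h2
      rw [← hn, ← h2]
      refine Finset.sum_congr rfl fun s _ => ?_
      rw [← charCoeff_inv hχ.conj_apply, ← htl,
        charCoeff_conjChar fun g x => hχ.apply_conj g x, mul_assoc, ← (hcomm s s.2).eq,
        inv_mul_cancel_left, ← MonoidHom.inv_apply b, Complex.conj_unitsHom_apply]
    exact_mod_cast mul_left_cancel₀ (mul_ne_zero hC0 hQ0) h1
  have key := Equiv.Perm.even_sum_sub_of_even_of_fixed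
    (σ := Equiv.inv (Subgroup.zpowers (t * t) →* ℂˣ)) (k := 1) (f := n) (i₀ := 1)
    (Equiv.ext fun b => inv_inv b) hninv
    (MonoidHom.ext fun _ => inv_one) ?_
  · rw [hsum, Int.even_sub] at key
    exact key.1 hd
  · intro b hb hb1
    have hbinv : ∀ s, b s = (b s)⁻¹ := fun s => (DFunLike.congr_fun hb s).symm
    have hbt : b ⟨t * t, Subgroup.mem_zpowers _⟩ = -1 := by
      have h1 : (b ⟨t * t, Subgroup.mem_zpowers _⟩ : ℂ) *
          b ⟨t * t, Subgroup.mem_zpowers _⟩ = 1 := by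
        rw [← Units.val_mul]
        nth_rewrite 1 [hbinv]
        rw [inv_mul_cancel, Units.val_one]
      rcases mul_self_eq_one_iff.1 h1 with h | h
      · exact absurd (unitsHom_eq_one_of_apply_generator (Units.ext h)) hb1
      · exact Units.ext h
    obtain ⟨k', hk', hsum'⟩ := hχ.exists_even_sum_sum l hlQ b t (Subgroup.mem_zpowers _) htl
      hcomm hbinv hbt
    rw [hswap, hn] at hsum'
    have h1 : n b = k' := by exact_mod_cast mul_left_cancel₀ (mul_ne_zero hC0 hQ0) hsum'
    rwa [h1]

end CyclicNormal

section Hyperelementary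

open scoped IsMulCommutative

/-- The stabilizer in `P` of a linear character of the normal subgroup `C`. -/
noncomputable def charStabilizer {G : Type*} [Group G] {C : Subgroup G} [C.Normal]
    (P : Subgroup G) (l : C →* ℂˣ) : Subgroup G where
  carrier := {g | g ∈ P ∧ conjChar g l = l}
  one_mem' := ⟨one_mem P, conjChar_one l⟩
  mul_mem' := fun {a b} ha hb => ⟨mul_mem ha.1 hb.1, by rw [conjChar_mul, hb.2, ha.2]⟩
  inv_mem' := fun {a} ha => ⟨inv_mem ha.1, by
    have h : conjChar a⁻¹ (conjChar a l) = l := by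
      rw [← conjChar_mul, inv_mul_cancel, conjChar_one]
    rwa [ha.2] at h⟩

theorem charStabilizer_le {G : Type*} [Group G] {C P : Subgroup G} [C.Normal]
    {l : C →* ℂˣ} : charStabilizer P l ≤ P := fun _ hs => hs.1

/-- The action of `P × {±1}` on the linear characters of a normal subgroup by conjugation
and inversion. -/
noncomputable abbrev conjInvAction {G : Type*} [Group G] (C P : Subgroup G) [C.Normal] :
    MulAction (P × ℤˣ) (C →* ℂˣ) where
  smul γ l := if γ.2 = 1 then conjChar γ.1 l else (conjChar γ.1 l)⁻¹
  one_smul l := conjChar_one l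
  mul_smul := by
    rintro ⟨p, ε⟩ ⟨q, δ⟩ l
    change (if ε * δ = 1 then conjChar ((p : G) * q) l else (conjChar ((p : G) * q) l)⁻¹) =
      if ε = 1 then conjChar (p : G) (if δ = 1 then conjChar (q : G) l else (conjChar (q : G) l)⁻¹)
      else (conjChar (p : G) (if δ = 1 then conjChar (q : G) l else (conjChar (q : G) l)⁻¹))⁻¹
    rw [conjChar_mul]
    rcases Int.units_eq_one_or ε with rfl | rfl <;> rcases Int.units_eq_one_or δ with rfl | rfl <;>
      simp [conjChar_inv, unitsHom_inv_inv]

theorem natCard_stabilizer_dvd {G : Type*} [Group G] [Finite G] {C P : Subgroup G} [C.Normal]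
    (l : C →* ℂˣ) (n : ℕ) (hn : n = 2 ∨ ∀ t ∈ P, conjChar t l ≠ l⁻¹) :
    letI := conjInvAction C P
    Nat.card (MulAction.stabilizer (P × ℤˣ) l) ∣ n * Nat.card (charStabilizer P l) := by
  let _ := conjInvAction C P
  let f : MulAction.stabilizer (P × ℤˣ) l →* ℤˣ := (MonoidHom.snd P ℤˣ).comp (Subgroup.subtype _)
  change Nat.card (MulAction.stabilizer (P × ℤˣ) l) ∣ _
  rw [← f.ker.index_mul_card, Subgroup.index_ker]
  refine mul_dvd_mul ?_ ?_
  · rcases hn with rfl | hn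
    · refine (Subgroup.card_subgroup_dvd_card f.range).trans ?_
      rw [Nat.card_eq_fintype_card]
      decide
    · have h1 : f.range = ⊥ := by
        rw [eq_bot_iff]
        rintro _ ⟨⟨⟨p, ε⟩, h⟩, rfl⟩
        refine (Int.units_eq_one_or ε).resolve_right ?_
        rintro rfl
        have h2 : (conjChar (p : G) l)⁻¹ = l := h
        exact hn p p.2 (by rw [← unitsHom_inv_inv (conjChar _ l), h2])
      rw [h1, Subgroup.card_bot]
      exact one_dvd _
  · let g : f.ker →* G := P.subtype.comp ((MonoidHom.fst P ℤˣ).comp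
      ((MulAction.stabilizer (P × ℤˣ) l).subtype.comp f.ker.subtype))
    have hg : ∀ x, g x ∈ charStabilizer P l := by
      rintro ⟨⟨⟨p, ε⟩, h⟩, hε⟩
      have h1 : ε = 1 := hε
      subst h1
      exact ⟨p.2, h⟩
    refine Subgroup.card_dvd_of_injective (g.codRestrict _ hg) ?_
    rintro ⟨⟨⟨p, ε⟩, h⟩, hε⟩ ⟨⟨⟨q, δ⟩, h'⟩, hδ⟩ hpq
    have h1 : ε = 1 := hε
    have h2 : δ = 1 := hδ
    have h3 := congrArg (fun z : charStabilizer P l => (z : G)) hpq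
    have h4 : p = q := Subtype.ext h3
    subst h1 h2 h4
    rfl

variable {G : Type*} [Group G] {C P : Subgroup G} [C.Normal] {χ : G → ℂ}

theorem IsRealVirtualCharacter.exists_int_sum_charCoeff [Finite G] [Fintype C] [Fintype P]
    (hχ : IsRealVirtualCharacter χ) (l : C →* ℂˣ) :
    ∃ n : ℤ, ∑ s : P, charCoeff χ l s =
      Nat.card C * (Nat.card (charStabilizer P l) * n : ℤ) ∧
      ((∃ n' : ℤ, Even n' ∧ ∀ [Fintype (charStabilizer P l)],
        ∑ s : charStabilizer P l, charCoeff χ l s =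
          Nat.card C * Nat.card (charStabilizer P l) * n') → Even n) := by
  classical
  let _ : Fintype (charStabilizer P l) := Fintype.ofFinite _
  obtain ⟨n, hn⟩ := hχ.exists_int_sum_sum (Q := charStabilizer P l) l (fun s hs => hs.2) 1
  have h1 : ∑ s : charStabilizer P l, charCoeff χ l s =
      Nat.card C * Nat.card (charStabilizer P l) * n := by
    rw [← hn, Finset.sum_comm]
    simp [charCoeff]
  refine ⟨n, ?_, ?_⟩
  · push_cast
    rw [← mul_assoc, ← h1]
    symm
    refine Fintype.sum_of_injective (Subgroup.inclusion charStabilizer_le)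
      (Subgroup.inclusion_injective _) _ _ (fun s hs => ?_) fun s => rfl
    refine charCoeff_eq_zero_of_conjChar_ne (fun g x => hχ.apply_conj g x) fun h => ?_
    exact hs ⟨⟨s, s.2, h⟩, rfl⟩
  · rintro ⟨n', hn', h2⟩
    have h3 : (Nat.card C * Nat.card (charStabilizer P l) : ℂ) ≠ 0 := by
      exact_mod_cast (Nat.mul_pos Nat.card_pos Nat.card_pos).ne'
    have h4 : n = n' := by exact_mod_cast mul_left_cancel₀ h3 (h1.symm.trans h2)
    rwa [h4]

theorem isComplement_of_sup_eq_top {u : G} [(Subgroup.zpowers u).Normal] (hu : Odd (orderOf u))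
    (hP : IsPGroup 2 P) (hsup : Subgroup.zpowers u ⊔ P = ⊤) :
    Subgroup.IsComplement' (Subgroup.zpowers u) P := by
  refine Subgroup.isComplement'_of_disjoint_and_mul_eq_univ ?_ ?_
  · rw [Subgroup.disjoint_def]
    intro x hx hxP
    obtain ⟨i, rfl⟩ := Subgroup.mem_zpowers_iff.1 hx
    refine hP.eq_one_of_odd hxP hu ?_
    rw [← zpow_natCast, ← zpow_mul, mul_comm, zpow_mul, zpow_natCast, pow_orderOf_eq_one,
      one_zpow]
  · rw [← Subgroup.normal_mul, hsup, Subgroup.coe_top]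

theorem IsRealVirtualCharacter.exists_int_sum_eq_of_hyperelementary [Fintype G] {u : G}
    [(Subgroup.zpowers u).Normal]
    (hχ : IsRealVirtualCharacter χ) (hvan : ∀ g p k, p.Prime → g ^ p ^ k = 1 → χ g = 0)
    (hG : ¬HasDihedralSubquotient G) (hu : Odd (orderOf u)) (hP : IsPGroup 2 P)
    (hsup : Subgroup.zpowers u ⊔ P = ⊤) : ∃ k : ℤ, ∑ g, χ g = 2 * Nat.card G * k := by
  classical
  let _ : Fintype (Subgroup.zpowers u) := Fintype.ofFinite _
  let _ : Fintype P := Fintype.ofFinite _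
  let _ : Fintype (Subgroup.zpowers u →* ℂˣ) := Fintype.ofFinite _
  have hC0 : (Nat.card (Subgroup.zpowers u) : ℂ) ≠ 0 := by exact_mod_cast Nat.card_pos.ne'
  choose n hn hneven using fun l : Subgroup.zpowers u →* ℂˣ =>
    hχ.exists_int_sum_charCoeff (P := P) l
  let F : (Subgroup.zpowers u →* ℂˣ) → ℤ := fun l => Nat.card (charStabilizer P l) * n l
  have hF : ∀ l, ∑ s : P, charCoeff χ l s = Nat.card (Subgroup.zpowers u) * F l := fun l => hn l
  have hFinv : ∀ l, F l⁻¹ = F l := by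
    intro l
    have h1 : (Nat.card (Subgroup.zpowers u) : ℂ) * F l⁻¹ =
        Nat.card (Subgroup.zpowers u) * F l := by
      have h2 := congrArg (starRingEnd ℂ) (hF l)
      simp only [map_sum, map_mul, Complex.conj_natCast, map_intCast] at h2
      rw [← hF, ← h2]
      exact Finset.sum_congr rfl fun s _ => charCoeff_inv hχ.conj_apply l s
    exact_mod_cast mul_left_cancel₀ hC0 h1
  have hFconj : ∀ (p : P) l, F (conjChar (p : G) l) = F l := by
    intro p l
    have h1 : (Nat.card (Subgroup.zpowers u) : ℂ) * F (conjChar (p : G) l) =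
        Nat.card (Subgroup.zpowers u) * F l := by
      rw [← hF, ← hF]
      refine Fintype.sum_equiv (MulAut.conj p⁻¹).toEquiv _ _ fun s => ?_
      rw [charCoeff_conjChar fun g x => hχ.apply_conj g x]
      change _ = charCoeff χ l (p⁻¹ * s * p⁻¹⁻¹ : P)
      rw [inv_inv]
      rfl
    exact_mod_cast mul_left_cancel₀ hC0 h1
  have hF0 : ∑ l, F l = 0 := by
    have h1 : (Nat.card (Subgroup.zpowers u) : ℂ) * ∑ l, (F l : ℂ) = 0 := by
      rw [Finset.mul_sum, Finset.sum_congr rfl fun l _ => (hF l).symm, Finset.sum_comm]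
      refine Finset.sum_eq_zero fun s _ => ?_
      unfold charCoeff
      rw [Finset.sum_comm]
      refine Finset.sum_eq_zero fun c _ => ?_
      rw [← Finset.sum_mul]
      have h2 := sum_unitsHom_apply c⁻¹
      simp only [map_inv, inv_eq_one] at h2
      rw [h2]
      split_ifs with hc
      · obtain ⟨i, hi⟩ := hP s
        rw [hc, Subgroup.coe_one, one_mul,
          hvan s 2 i Nat.prime_two (by simpa using congrArg Subtype.val hi), mul_zero]
      · rw [zero_mul]
    exact_mod_cast (mul_eq_zero.1 h1).resolve_left hC0
  have hF1 : ∑ g, χ g = Nat.card (Subgroup.zpowers u) * F 1 := by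
    rw [← hF, ← (Equiv.ofBijective _ (isComplement_of_sup_eq_top hu hP hsup)).sum_comp,
      Fintype.sum_prod_type, Finset.sum_comm]
    simp [charCoeff]
  let _ := conjInvAction (Subgroup.zpowers u) P
  have key := MulAction.card_dvd_sum_of_card_stabilizer_dvd (Γ := P × ℤˣ)
    (X := Subgroup.zpowers u →* ℂˣ)
    (fun l => if l = 1 then 0 else F l) ?_ ?_
  · have h1 : ∑ l, F l = F 1 + ∑ l, if l = 1 then 0 else F l := by
      rw [← Finset.add_sum_erase _ _ (Finset.mem_univ 1),
        ← Finset.sum_erase (f := fun l => if l = 1 then 0 else F l) (a := 1) _ (if_pos rfl)]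
      congr 1
      exact Finset.sum_congr rfl fun l hl => (if_neg (Finset.ne_of_mem_erase hl)).symm
    obtain ⟨k, hk⟩ := key
    have h2 : F 1 = 2 * Nat.card P * -k := by
      have h3 : Nat.card (P × ℤˣ) = Nat.card P * 2 := by
        rw [Nat.card_prod, Nat.card_eq_fintype_card (α := ℤˣ)]
        rfl
      rw [hF0, hk, h3] at h1
      push_cast at h1
      linear_combination -h1
    refine ⟨-k, ?_⟩
    rw [hF1, h2, ← (isComplement_of_sup_eq_top hu hP hsup).card_mul_card]
    push_cast
    ring
  · rintro ⟨p, ε⟩ l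
    have h1 : ∀ l : Subgroup.zpowers u →* ℂˣ, (if conjChar (p : G) l = 1 then 0 else
        F (conjChar (p : G) l)) = if l = 1 then 0 else F l := by
      intro l
      have h2 : conjChar (p : G) l = 1 ↔ l = 1 := by
        rw [← conjChar_trivial (p : G)]
        exact (conjCharPerm _ (p : G)).injective.eq_iff
      simp only [h2, hFconj]
    rcases Int.units_eq_one_or ε with rfl | rfl
    · exact h1 l
    · refine Eq.trans ?_ (h1 l)
      have h2 : (conjChar (p : G) l)⁻¹ = 1 ↔ conjChar (p : G) l = 1 := by
        constructor
        · intro h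
          rw [← unitsHom_inv_inv (conjChar _ l), h]
          exact MonoidHom.ext fun _ => inv_one
        · intro h
          rw [h]
          exact MonoidHom.ext fun _ => inv_one
      change (if (conjChar (p : G) l)⁻¹ = 1 then 0 else F (conjChar (p : G) l)⁻¹) = _
      simp only [h2, hFinv]
  · intro l
    split_ifs with hl
    · exact dvd_zero _
    · by_cases h : ∃ t ∈ P, conjChar t l = l⁻¹
      · obtain ⟨t, htP, htl⟩ := h
        have heven : Even (n l) := by
          refine hneven l ?_
          let _ : Fintype (charStabilizer P l) := Fintype.ofFinite _
          obtain ⟨n', h1, h2⟩ := hχ.exists_even_sum_charCoeff hvan hG hu hP hl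
            (Q := charStabilizer P l) (fun s => Iff.rfl) htP htl
          exact ⟨n', h1, by
            intro inst
            convert h2⟩
        obtain ⟨m, hm⟩ := heven
        refine (Int.natCast_dvd_natCast.2 (natCard_stabilizer_dvd l 2 (Or.inl rfl))).trans
          ⟨m, ?_⟩
        change (Nat.card (charStabilizer P l) * n l : ℤ) = _
        rw [hm]
        push_cast
        ring
      · push Not at h
        refine (Int.natCast_dvd_natCast.2 (natCard_stabilizer_dvd l 1 (Or.inr h))).trans ?_
        rw [one_mul]
        exact dvd_mul_right _ _

end Hyperelementary

theorem exists_int_sum_eq_of_not_hasDihedralSubquotient (N : ℕ) :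
    ∀ (G : Type) [Group G] [Fintype G], Nat.card G = N → ¬HasDihedralSubquotient G →
      ∀ χ : G → ℂ, IsRealVirtualCharacter χ → (∀ g p k, p.Prime → g ^ p ^ k = 1 → χ g = 0) →
        ∃ k : ℤ, ∑ g, χ g = 2 * Nat.card G * k := by
  induction N using Nat.strong_induction_on with
  | _ N ih =>
  intro G _ _ hN hG χ hχ hvan
  choose u P hu hP hPu hodd using exists_odd_natCard_fixed_quotient (G := G)
  by_cases htop : ∃ g, Subgroup.zpowers (u g) ⊔ P g = ⊤
  · obtain ⟨g, hg⟩ := htop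
    have hnorm : (Subgroup.zpowers (u g)).Normal := by
      rw [← Subgroup.normalizer_eq_top_iff, eq_top_iff, ← hg]
      exact sup_le Subgroup.le_normalizer (hPu g)
    exact hχ.exists_int_sum_eq_of_hyperelementary hvan hG (hu g) (hP g) hg
  · push Not at htop
    refine exists_int_sum_eq_of_odd_fixed (fun g x => hχ.apply_conj g x) (fun E hE => ?_) ?_ _
      htop hodd
    · let _ : Fintype E := Fintype.ofFinite _
      rw [finsum_eq_sum_of_fintype]
      refine ih (Nat.card E) ?_ E rfl (fun h => hG h.of_subgroup) _ (hχ.comp E.subtype)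
        fun g p k hp hg => hvan _ p k hp (by exact_mod_cast congrArg Subtype.val hg)
      rw [← hN]
      exact lt_of_le_of_ne (Subgroup.card_le_card_group E)
        fun h => hE (Subgroup.eq_top_of_card_eq E h)
    · obtain ⟨k, hk⟩ := hχ.exists_int_sum (MonoidHom.id G) 1
      exact ⟨k, by simpa using hk⟩

section PrimaryMatched

variable {G : Type} [Group G]

theorem FDRep.exists_matrix_trace (V : FDRep ℝ G) :
    ∃ n, ∃ ρ : G →* Matrix (Fin n) (Fin n) ℝ, ∀ g, (ρ g).trace = LinearMap.trace ℝ V (V.ρ g) := by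
  let b := Module.finBasis ℝ V
  refine ⟨_, (MonoidHomClass.toMonoidHom (LinearMap.toMatrixAlgEquiv b)).comp V.ρ, fun g => ?_⟩
  rw [LinearMap.trace_eq_matrix_trace ℝ b]
  rfl

theorem PrimaryMatchedReal.trace_eq {V₀ V₁ : FDRep ℝ G} (h : PrimaryMatchedReal V₀ V₁) {g : G}
    {p k : ℕ} (hp : p.Prime) (hg : g ^ p ^ k = 1) :
    LinearMap.trace ℝ V₀ (V₀.ρ g) = LinearMap.trace ℝ V₁ (V₁.ρ g) := by
  obtain ⟨e, he⟩ := h p hp (Subgroup.zpowers g) (by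
    rintro ⟨x, hx⟩
    obtain ⟨i, rfl⟩ := Subgroup.mem_zpowers_iff.1 hx
    refine ⟨k, Subtype.ext ?_⟩
    change (g ^ i) ^ p ^ k = 1
    rw [← zpow_natCast, ← zpow_mul, mul_comm, zpow_mul, zpow_natCast, hg, one_zpow])
  rw [← LinearMap.trace_conj' (V₀.ρ g) e]
  congr 1
  ext v
  rw [LinearEquiv.conj_apply_apply, he g (Subgroup.mem_zpowers g), LinearEquiv.apply_symm_apply]

theorem FDRep.sum_trace_eq_natCard_mul_finrank [Fintype G] (V : FDRep ℝ G) :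
    ∑ g, LinearMap.trace ℝ V (V.ρ g) =
      Nat.card G * Module.finrank ℝ (Representation.invariants V.ρ) := by
  have h0 : (Nat.card G : ℝ) ≠ 0 := by exact_mod_cast Nat.card_pos.ne'
  let _ : Invertible (Nat.card G : ℝ) := invertibleOfNonzero h0
  rw [← Representation.card_inv_mul_sum_char_eq_finrank V.ρ, mul_inv_cancel_left₀ h0]
  rfl

theorem PrimaryMatchedReal.hasDihedralSubquotient [Finite G] {V₀ V₁ : FDRep ℝ G}
    (h : PrimaryMatchedReal V₀ V₁)
    (h₀ : Module.finrank ℝ (Representation.invariants V₀.ρ) = 0)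
    (h₁ : Module.finrank ℝ (Representation.invariants V₁.ρ) = 1) : HasDihedralSubquotient G := by
  by_contra hG
  let _ : Fintype G := Fintype.ofFinite G
  obtain ⟨m, ρ, hρ⟩ := V₁.exists_matrix_trace
  obtain ⟨n, σ, hσ⟩ := V₀.exists_matrix_trace
  obtain ⟨k, hk⟩ := exists_int_sum_eq_of_not_hasDihedralSubquotient _ G rfl hG
    (fun g => ((ρ g).trace : ℂ) - ((σ g).trace : ℂ)) ⟨m, n, ρ, σ, fun g => rfl⟩
    fun g p k hp hg => by rw [hρ, hσ, h.trace_eq hp hg, sub_self]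
  simp only [hρ, hσ, Finset.sum_sub_distrib, ← Complex.ofReal_sum,
    FDRep.sum_trace_eq_natCard_mul_finrank, h₀, h₁] at hk
  have h2 : (Nat.card G : ℤ) * 1 = Nat.card G * (2 * k) := by
    have h3 : (Nat.card G : ℂ) * 1 = Nat.card G * (2 * k) := by
      push_cast at hk
      linear_combination hk
    exact_mod_cast h3
  have h4 := mul_left_cancel₀ (Int.natCast_ne_zero.2 Nat.card_pos.ne') h2
  omega

end PrimaryMatched

/-- For a finite group `G`, there exist finite-dimensional real representations
`V₀`, `V₁` of `G` that are primary matched over ℝ with `dim_ℝ V₀^G = 0` and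
`dim_ℝ V₁^G = 1`, if and only if `G` has subgroups `K ⊴ H ≤ G` with `H/K` isomorphic to
the dihedral group of order `2pq` for two distinct primes `p` and `q`. -/
theorem exists_primaryMatched_real_iff (G : Type) [Group G] [Finite G] :
    (∃ V₀ V₁ : FDRep ℝ G, PrimaryMatchedReal V₀ V₁ ∧
        Module.finrank ℝ (Representation.invariants V₀.ρ) = 0 ∧
        Module.finrank ℝ (Representation.invariants V₁.ρ) = 1) ↔
      HasDihedralSubquotient G := by
  exact ⟨fun ⟨_, _, h, h₀, h₁⟩ => h.hasDihedralSubquotient h₀ h₁,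
    exists_primaryMatched_of_dihedral⟩
end

section
/- The group S₃ × A₄, the direct product of the symmetric group on 3 letters and the alternating group on 4 letters (a solvable group of order 72), is an Oliver group. -/
/-- A finite group `G` *contains an Oliver series* if there are subgroups
`P ≤ H ≤ G` with `P` normal in `H` and `H` normal in `G`, such that `|P|` is a prime
power `p ^ a` (with `a ≥ 0`, so the trivial group is allowed), `|G/H|` is a prime power
`q ^ b` (with `b ≥ 0`), and `H/P` is cyclic. -/
def HasOliverSeries (G : Type*) [Group G] : Prop :=
  ∃ P H : Subgroup G, ∃ _ : P ≤ H, ∃ _ : H.Normal, ∃ hP : (P.subgroupOf H).Normal,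
    (∃ p a : ℕ, p.Prime ∧ Nat.card P = p ^ a) ∧
    (∃ q b : ℕ, q.Prime ∧ Nat.card (G ⧸ H) = q ^ b) ∧
    (letI := hP; IsCyclic (H ⧸ P.subgroupOf H))

/-- A finite group is an *Oliver group* if it contains no Oliver series. -/
def IsOliverGroup (G : Type*) [Group G] : Prop := ¬ HasOliverSeries G

theorem IsCyclic.exists_pow_eq_of_pow_prime_eq_one {G : Type*} [Group G] [Finite G] [IsCyclic G]
    {r : ℕ} (hr : r.Prime) {x y : G} (hx : x ^ r = 1) (hx1 : x ≠ 1) (hy : y ^ r = 1) :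
    ∃ i < r, x ^ i = y := by
  classical
  have := Fintype.ofFinite G
  have := Fact.mk hr
  have ho : orderOf x = r := orderOf_eq_prime hx hx1
  have hinj : Set.InjOn (fun i : ℕ => x ^ i) (Finset.range r) := by
    simpa [ho] using pow_injOn_Iio_orderOf (x := x)
  have hsub : (Finset.range r).image (fun i : ℕ => x ^ i) ⊆
      Finset.univ.filter fun g : G => g ^ r = 1 := by
    intro g hg
    obtain ⟨i, -, rfl⟩ := Finset.mem_image.1 hg
    simp [pow_right_comm x i r, hx]
  have heq := Finset.eq_of_subset_of_card_le hsub (by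
    rw [Finset.card_image_of_injOn hinj, Finset.card_range]
    exact IsCyclic.card_pow_eq_one_le hr.pos)
  have hmem : y ∈ (Finset.range r).image (fun i : ℕ => x ^ i) := by
    rw [heq]; simpa using hy
  simpa using hmem

namespace Subgroup

variable {G : Type*} [Group G]

theorem mem_of_pow_prime_eq_one_of_card_quotient {H : Subgroup G} [H.Normal] {q b r : ℕ}
    (hq : q.Prime) (hr : r.Prime) (hqr : q ≠ r) (hH : Nat.card (G ⧸ H) = q ^ b) {z : G}
    (hz : z ^ r = 1) : z ∈ H := by
  rw [← QuotientGroup.eq_one_iff, ← orderOf_eq_one_iff]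
  have h1 : orderOf (z : G ⧸ H) ∣ r := by
    apply orderOf_dvd_of_pow_eq_one
    rw [← QuotientGroup.mk_pow, hz, QuotientGroup.mk_one]
  have h2 : orderOf (z : G ⧸ H) ∣ q ^ b := hH ▸ _root_.orderOf_dvd_natCard (z : G ⧸ H)
  exact Nat.eq_one_of_dvd_coprimes (((Nat.coprime_primes hq hr).2 hqr).pow_left b) h2 h1

theorem prime_dvd_card_of_mem {P : Subgroup G} {r : ℕ} (hr : r.Prime) {z : G}
    (hz : z ^ r = 1) (hz1 : z ≠ 1) (hzP : z ∈ P) : r ∣ Nat.card P := by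
  have := Fact.mk hr
  rw [← orderOf_eq_prime hz hz1]
  exact P.orderOf_dvd_natCard hzP

variable {P H : Subgroup G} [hP : (P.subgroupOf H).Normal] [IsCyclic (H ⧸ P.subgroupOf H)]

open scoped commutatorElement in
theorem commutatorElement_mem_of_isCyclic_quotient {u v : G} (hu : u ∈ H) (hv : v ∈ H) :
    ⁅u, v⁆ ∈ P := by
  have key : (⁅(⟨u, hu⟩ : H), ⟨v, hv⟩⁆ : H) ∈ P.subgroupOf H := by
    let := IsCyclic.commGroup (α := H ⧸ P.subgroupOf H)
    rw [← QuotientGroup.eq_one_iff, ← QuotientGroup.mk'_apply, map_commutatorElement,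
      commutatorElement_eq_one_iff_mul_comm]
    exact mul_comm _ _
  exact mem_subgroupOf.1 key

theorem prime_dvd_card_of_isCyclic_quotient [Finite G] {r : ℕ} (hr : r.Prime) {x y : G}
    (hxH : x ∈ H) (hyH : y ∈ H) (hxy : Commute x y) (hx : x ^ r = 1) (hy : y ^ r = 1)
    (hx1 : x ≠ 1) (hne : ∀ i < r, x ^ i ≠ y) : r ∣ Nat.card P := by
  by_cases hxP : x ∈ P
  · exact prime_dvd_card_of_mem hr hx hx1 hxP
  let f := QuotientGroup.mk' (P.subgroupOf H)
  obtain ⟨i, hi, h⟩ := IsCyclic.exists_pow_eq_of_pow_prime_eq_one hr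
    (x := f ⟨x, hxH⟩) (y := f ⟨y, hyH⟩)
    (by rw [← map_pow, show (⟨x, hxH⟩ : H) ^ r = 1 from Subtype.ext hx, map_one])
    (fun h => hxP (mem_subgroupOf.1 ((QuotientGroup.eq_one_iff _).1 h)))
    (by rw [← map_pow, show (⟨y, hyH⟩ : H) ^ r = 1 from Subtype.ext hy, map_one])
  rw [← map_pow] at h
  have hz : (x ^ i)⁻¹ * y ∈ P := mem_subgroupOf.1 (QuotientGroup.eq.1 h)
  refine prime_dvd_card_of_mem hr ?_ (fun h => hne i hi (inv_mul_eq_one.1 h)) hz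
  rw [((hxy.pow_left i).inv_left).mul_pow, inv_pow, ← pow_mul, mul_comm i r, pow_mul, hx, hy]
  simp

end Subgroup

theorem isSolvable_perm_fin_three : Group.IsSolvable (Equiv.Perm (Fin 3)) := by
  have : IsCyclic (alternatingGroup (Fin 3)) := by
    have := Fact.mk Nat.prime_three
    exact isCyclic_of_prime_card (p := 3) (by rw [nat_card_alternatingGroup]; simp; rfl)
  let := IsCyclic.commGroup (α := alternatingGroup (Fin 3))
  exact Group.isSolvable_of_ker_le_range (alternatingGroup (Fin 3)).subtype Equiv.Perm.sign
    (by rw [Subgroup.range_subtype]; exact le_of_eq rfl)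

theorem isSolvable_alternatingGroup_fin_four : Group.IsSolvable (alternatingGroup (Fin 4)) := by
  have hc : Nat.card (Fin 4) = 4 := by simp
  have := alternatingGroup.kleinFour_isKleinFour hc
  refine ⟨2, ?_⟩
  rw [derivedSeries_succ, derivedSeries_one, ← alternatingGroup.kleinFour_eq_commutator hc,
    Subgroup.commutator_eq_bot_iff_le_centralizer]
  have hcomm := IsKleinFour.isMulCommutative (G := alternatingGroup.kleinFour (Fin 4))
  exact fun x hx y hy => congrArg Subtype.val (hcomm.is_comm.comm ⟨y, hy⟩ ⟨x, hx⟩)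

/-- The group `S₃ × A₄`, the direct product of the symmetric group on `3` letters and
the alternating group on `4` letters — a solvable group of order `72` — is an Oliver
group. -/
theorem isOliverGroup_S3_prod_A4 :
    IsSolvable (Equiv.Perm (Fin 3) × alternatingGroup (Fin 4)) ∧
    Nat.card (Equiv.Perm (Fin 3) × alternatingGroup (Fin 4)) = 72 ∧
    IsOliverGroup (Equiv.Perm (Fin 3) × alternatingGroup (Fin 4)) := by
  have := isSolvable_perm_fin_three
  have := isSolvable_alternatingGroup_fin_four
  refine ⟨(inferInstance : Group.IsSolvable _), ?_, ?_⟩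
  · rw [Nat.card_prod, nat_card_alternatingGroup, Nat.card_perm]
    simp [Nat.factorial]
  rintro ⟨P, H, -, hH, hP, ⟨p, a, hp, hPcard⟩, ⟨q, b, hq, hHcard⟩, hcyc⟩
  have eq_of_dvd : ∀ r : ℕ, r.Prime → r ∣ Nat.card P → r = p := fun r hr h =>
    (Nat.prime_dvd_prime_iff_eq hr hp).1 (hr.dvd_of_dvd_pow (hPcard ▸ h))
  suffices h : 2 ∣ Nat.card P ∧ 3 ∣ Nat.card P by
    have h2 := eq_of_dvd 2 Nat.prime_two h.1
    have h3 := eq_of_dvd 3 Nat.prime_three h.2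
    omega
  let c : Equiv.Perm (Fin 3) := Equiv.swap 0 1 * Equiv.swap 1 2
  let t : alternatingGroup (Fin 4) := ⟨Equiv.swap 0 1 * Equiv.swap 1 2,
    Equiv.Perm.mem_alternatingGroup.2 (by decide)⟩
  let t' : alternatingGroup (Fin 4) := ⟨Equiv.swap 1 2 * Equiv.swap 2 3,
    Equiv.Perm.mem_alternatingGroup.2 (by decide)⟩
  let v : alternatingGroup (Fin 4) := ⟨Equiv.swap 0 1 * Equiv.swap 2 3,
    Equiv.Perm.mem_alternatingGroup.2 (by decide)⟩
  let w : alternatingGroup (Fin 4) := ⟨Equiv.swap 0 2 * Equiv.swap 1 3,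
    Equiv.Perm.mem_alternatingGroup.2 (by decide)⟩
  by_cases hq3 : q = 3
  · have hmem : ∀ z : Equiv.Perm (Fin 3) × alternatingGroup (Fin 4), z ^ 2 = 1 → z ∈ H :=
      fun z hz => Subgroup.mem_of_pow_prime_eq_one_of_card_quotient hq Nat.prime_two
        (by omega) hHcard hz
    constructor
    · exact Subgroup.prime_dvd_card_of_isCyclic_quotient (H := H) Nat.prime_two
        (x := (1, v)) (y := (1, w)) (hmem _ (by decide)) (hmem _ (by decide))
        (show _ = _ by decide) (by decide) (by decide) (by decide) (by decide)
    · exact Subgroup.prime_dvd_card_of_mem Nat.prime_three (by decide) (by decide)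
        (Subgroup.commutatorElement_mem_of_isCyclic_quotient (H := H)
          (hmem (Equiv.swap 0 1, 1) (by decide)) (hmem (Equiv.swap 1 2, 1) (by decide)))
  · have hmem : ∀ z : Equiv.Perm (Fin 3) × alternatingGroup (Fin 4), z ^ 3 = 1 → z ∈ H :=
      fun z hz => Subgroup.mem_of_pow_prime_eq_one_of_card_quotient hq Nat.prime_three
        hq3 hHcard hz
    constructor
    · exact Subgroup.prime_dvd_card_of_mem Nat.prime_two (by decide) (by decide)
        (Subgroup.commutatorElement_mem_of_isCyclic_quotient (H := H)
          (hmem (1, t) (by decide)) (hmem (1, t') (by decide)))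
    · exact Subgroup.prime_dvd_card_of_isCyclic_quotient (H := H) Nat.prime_three
        (x := (c, 1)) (y := (1, t)) (hmem _ (by decide)) (hmem _ (by decide))
        (show _ = _ by decide) (by decide) (by decide) (by decide) (by decide)
end
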